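/- For every integer n ≥ 2 and every non-negative integer t, the matching complex M(P_{n,t}) of the polygonal line tiling P_{n,t} of t (2n)-gons is homotopy equivalent to a wedge of spheres. -/

import Mathlib

/-! ## Simplicial complexes, realizations, and homotopy-theoretic notions -/

/-- The independence complex of a simple graph, as an abstract simplicial complex:
the collection of finite independent sets of vertices. -/
def indepCx {V : Type} (G : SimpleGraph V) : Set (Finset V) :=
  {s | ∀ u ∈ s, ∀ v ∈ s, ¬ G.Adj u v}

/-- The matching complex of a simple graph: the collection of finite sets of edges,
no two of which share an endpoint. -/
def matchCx {V : Type} (G : SimpleGraph V) : Set (Finset (Sym2 V)) :=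
  {s | (↑s : Set (Sym2 V)) ⊆ G.edgeSet ∧
    ∀ e ∈ s, ∀ e' ∈ s, e ≠ e' → ∀ x : V, x ∈ e → x ∉ e'}

/-- The geometric realization of an abstract simplicial complex `K` on vertex set `V`:
the space of convex-combination weight functions supported on a simplex of `K`. -/
def geom {V : Type} (K : Set (Finset V)) : Type :=
  {f : V → ℝ // (∃ s ∈ K, ∀ v, f v ≠ 0 → v ∈ s) ∧ (∀ v, 0 ≤ f v) ∧ ∑ᶠ v, f v = 1}

noncomputable instance geom.topInst {V : Type} (K : Set (Finset V)) :
    TopologicalSpace (geom K) :=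
  instTopologicalSpaceSubtype

/-- A continuous map is a homotopy equivalence. -/
def IsHtpyEquiv {X Y : Type} [TopologicalSpace X] [TopologicalSpace Y] (f : C(X, Y)) : Prop :=
  ∃ g : C(Y, X), (g.comp f).Homotopic (ContinuousMap.id X) ∧
    (f.comp g).Homotopic (ContinuousMap.id Y)

/-- Any singleton vertex set is independent. -/
lemma singleton_mem_indepCx {V : Type} (G : SimpleGraph V) (v : V) :
    ({v} : Finset V) ∈ indepCx G := by
  intro u hu w hw
  simp only [Finset.mem_singleton] at hu hw
  subst hu; subst hw
  exact G.irrefl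

/-- The point of a geometric realization corresponding to a vertex. -/
noncomputable def geomPt {V : Type} [DecidableEq V] {K : Set (Finset V)} (v : V)
    (h : ({v} : Finset V) ∈ K) : geom K := by
  refine ⟨fun w => if w = v then 1 else 0, ⟨{v}, h, fun w hw => ?_⟩, fun w => ?_, ?_⟩
  · by_cases hwv : w = v
    · simp [hwv]
    · simp [hwv] at hw
  · by_cases hwv : w = v <;> simp [hwv]
  · rw [finsum_eq_single _ v (fun x hx => if_neg hx)]
    simp

/-- The `k`-dimensional sphere. -/
def Sph (k : ℕ) : Type := Metric.sphere (0 : EuclideanSpace ℝ (Fin (k+1))) 1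

noncomputable instance Sph.topInst (k : ℕ) : TopologicalSpace (Sph k) := by
  unfold Sph; infer_instance

/-- A pointed topological space. -/
structure Ptd where
  carrier : Type
  [topInst : TopologicalSpace carrier]
  pt : carrier

attribute [instance] Ptd.topInst

/-- The one-point pointed space. -/
def Ptd.point : Ptd := { carrier := PUnit, pt := PUnit.unit }

/-- The `k`-sphere as a pointed space. -/
noncomputable def Ptd.sphere (k : ℕ) : Ptd where
  carrier := Sph k
  pt := ⟨EuclideanSpace.single 0 1, by
    simp [mem_sphere_iff_norm, EuclideanSpace.norm_single]⟩

/-- The wedge sum of two pointed spaces. -/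
def Ptd.wedge (X Y : Ptd) : Ptd where
  carrier := Quot (fun p q : X.carrier ⊕ Y.carrier => p = q ∨
    (p = Sum.inl X.pt ∧ q = Sum.inr Y.pt) ∨ (p = Sum.inr Y.pt ∧ q = Sum.inl X.pt))
  pt := Quot.mk _ (Sum.inl X.pt)

/-- The reduced suspension of a pointed space: in `X × [0,1]`, collapse
`X × {0} ∪ X × {1} ∪ {pt} × [0,1]` to a point. -/
def Ptd.susp (X : Ptd) : Ptd where
  carrier := Quot (fun p q : X.carrier × unitInterval => p = q ∨
    ((p.2 = 0 ∨ p.2 = 1 ∨ p.1 = X.pt) ∧ (q.2 = 0 ∨ q.2 = 1 ∨ q.1 = X.pt)))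
  pt := Quot.mk _ (X.pt, 0)

/-- Iterated reduced suspension `Σ^k`. -/
def Ptd.suspIter (k : ℕ) (X : Ptd) : Ptd := Ptd.susp^[k] X

/-- The wedge of `k` copies of a pointed space (the empty wedge being a point). -/
def Ptd.wedgeIter : ℕ → Ptd → Ptd
  | 0, _ => Ptd.point
  | k+1, X => (Ptd.wedgeIter k X).wedge X

/-- A finite wedge of spheres of prescribed dimensions (the empty wedge being a point). -/
noncomputable def wedgeOfSpheres : List ℕ → Ptd
  | [] => Ptd.point
  | d :: ds => (Ptd.sphere d).wedge (wedgeOfSpheres ds)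

/-- A space is `k`-connected (`k : ℤ`): it is nonempty whenever `k ≥ -1`, and every
continuous map from a sphere of dimension `≤ k` into it is null-homotopic. -/
def IsConn (X : Type) [TopologicalSpace X] (k : ℤ) : Prop :=
  (-1 ≤ k → Nonempty X) ∧
    ∀ i : ℕ, (i : ℤ) ≤ k → ∀ f : C(Sph i, X), ∃ x : X,
      f.Homotopic (ContinuousMap.const _ x)

/-! ## Inclusions of independence complexes of induced subgraphs -/

/-- Extension by zero of a function defined on a subset of `V`. -/
noncomputable def extendZero {V : Type} {S : Set V} (f : ↥S → ℝ) : V → ℝ :=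
  Function.extend Subtype.val f 0

lemma extendZero_mem {V : Type} {S : Set V} (f : ↥S → ℝ) (x : ↥S) :
    extendZero f ↑x = f x :=
  Subtype.val_injective.extend_apply f 0 x

lemma extendZero_not_mem {V : Type} {S : Set V} (f : ↥S → ℝ) {v : V} (h : v ∉ S) :
    extendZero f v = 0 :=
  Function.extend_apply' f (0 : V → ℝ) v (fun ⟨x, hx⟩ => h (hx ▸ x.2))

lemma finsum_extendZero {V : Type} {S : Set V} (f : ↥S → ℝ) :
    ∑ᶠ v, extendZero f v = ∑ᶠ x : ↥S, f x := by
  rw [show (fun x : ↥S => f x) = fun x : ↥S => extendZero f ↑x from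
      funext fun x => (extendZero_mem f x).symm,
    finsum_set_coe_eq_finsum_mem, ← finsum_mem_univ (f := extendZero f),
    finsum_mem_inter_support_eq' _ Set.univ S]
  intro x hx
  simp only [Set.mem_univ, true_iff]
  exact by_contra fun h => hx (extendZero_not_mem f h)

/-- An independent set of an induced subgraph is independent in the ambient graph. -/
lemma indep_image {V : Type} [DecidableEq V] (G : SimpleGraph V) (S : Set V)
    {s : Finset ↥S} (hs : s ∈ indepCx (G.induce S)) :
    s.image Subtype.val ∈ indepCx G := by
  intro u hu v hv
  simp only [Finset.mem_image] at hu hv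
  obtain ⟨u', hu', rfl⟩ := hu
  obtain ⟨v', hv', rfl⟩ := hv
  exact hs u' hu' v' hv'

/-- The inclusion of the realization of the independence complex of an induced
subgraph into that of the ambient graph (extension of weight functions by zero). -/
noncomputable def inclMap {V : Type} [DecidableEq V] (G : SimpleGraph V) (S : Set V) :
    C(geom (indepCx (G.induce S)), geom (indepCx G)) where
  toFun f := ⟨extendZero f.1, by
      obtain ⟨s, hsK, hsupp⟩ := f.2.1
      refine ⟨s.image Subtype.val, indep_image G S hsK, fun v hv => ?_⟩
      by_cases h : v ∈ S
      · rw [show v = ↑(⟨v, h⟩ : ↥S) from rfl, extendZero_mem] at hv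
        exact Finset.mem_image.2 ⟨⟨v, h⟩, hsupp _ hv, rfl⟩
      · exact absurd (extendZero_not_mem f.1 h) hv,
    fun v => by
      by_cases h : v ∈ S
      · rw [show v = ↑(⟨v, h⟩ : ↥S) from rfl, extendZero_mem]; exact f.2.2.1 _
      · rw [extendZero_not_mem f.1 h],
    by rw [finsum_extendZero]; exact f.2.2.2⟩
  continuous_toFun := by
    apply Continuous.subtype_mk
    apply continuous_pi
    intro v
    by_cases h : v ∈ S
    · have : (fun f : geom (indepCx (G.induce S)) => extendZero f.1 v) =
        fun f : geom (indepCx (G.induce S)) => f.1 ⟨v, h⟩ :=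
        funext fun f => extendZero_mem f.1 ⟨v, h⟩
      rw [this]
      exact (continuous_apply _).comp continuous_subtype_val
    · have : (fun f : geom (indepCx (G.induce S)) => extendZero f.1 v) =
        fun _ => (0 : ℝ) := funext fun f => extendZero_not_mem f.1 h
      rw [this]
      exact continuous_const

/-! ## The graphs `G_{n,t}` and `H_{n,t}` (line graphs of polygonal line tilings) -/

/-- Ambient vertex names for the graphs `G_{n,t}`: `a i`, `b i j`, `c i j`. -/
inductive GV : Type
  | a : ℕ → GV
  | b : ℕ → ℕ → GV
  | c : ℕ → ℕ → GV
deriving DecidableEq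

/-- The base adjacency rules of `G_{n,t}` on the ambient vertex names (the parameter
`t` is handled by restricting to the appropriate vertex set). -/
def gRel (n : ℕ) : GV → GV → Prop
  | .a i, .b i' j => i' = i + 1 ∧ (j = 1 ∨ j = n - 1)
  | .a i, .c i' j => i' = i ∧ (j = 1 ∨ j = n - 1)
  | .b i j, .b i' j' => (i' = i ∧ j' = j + 1) ∨ (i' = i + 1 ∧ j = n - 1 ∧ j' = 1)
  | .c i j, .c i' j' => (i' = i ∧ j' = j + 1) ∨ (i' = i + 1 ∧ j = n - 1 ∧ j' = 1)
  | _, _ => False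

/-- The graph on all ambient vertex names with the adjacency rules of the `G_{n,t}`. -/
def gFull (n : ℕ) : SimpleGraph GV := SimpleGraph.fromRel (gRel n)

/-- The vertex set of `G_{n,t}`:
`{a_0, …, a_t} ∪ {b_{i,j}, c_{i,j} : 1 ≤ i ≤ t, 1 ≤ j ≤ n-1}`. -/
def GVset (n t : ℕ) : Set GV :=
  {v | match v with
    | .a i => i ≤ t
    | .b i j => 1 ≤ i ∧ i ≤ t ∧ 1 ≤ j ∧ j ≤ n - 1
    | .c i j => 1 ≤ i ∧ i ≤ t ∧ 1 ≤ j ∧ j ≤ n - 1}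

/-- The graph `G_{n,t}`, the line graph of the polygonal line tiling of `t` `2n`-gons. -/
def lineG (n t : ℕ) : SimpleGraph (GVset n t) := (gFull n).induce (GVset n t)

/-- The vertex set of `H_{n,t}`: that of `G_{n,t}` plus `b_{t+1,1}` and `c_{t+1,1}`. -/
def HVset (n t : ℕ) : Set GV := GVset n t ∪ {GV.b (t+1) 1, GV.c (t+1) 1}

/-- The graph `H_{n,t}`, the induced subgraph of `G_{n,t+1}` on
`V(G_{n,t}) ∪ {b_{t+1,1}, c_{t+1,1}}`. -/
def lineH (n t : ℕ) : SimpleGraph (HVset n t) := (gFull n).induce (HVset n t)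

lemma a0_mem_GVset (n t : ℕ) : GV.a 0 ∈ GVset n t := by simp [GVset]

lemma a0_mem_HVset (n t : ℕ) : GV.a 0 ∈ HVset n t := Or.inl (a0_mem_GVset n t)

/-- The realization of `I(G_{n,t})`, pointed at the vertex `a_0`. -/
noncomputable def IG (n t : ℕ) : Ptd where
  carrier := geom (indepCx (lineG n t))
  pt := geomPt ⟨GV.a 0, a0_mem_GVset n t⟩ (singleton_mem_indepCx _ _)

/-- The realization of `I(H_{n,t})`, pointed at the vertex `a_0`. -/
noncomputable def IH (n t : ℕ) : Ptd where
  carrier := geom (indepCx (lineH n t))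
  pt := geomPt ⟨GV.a 0, a0_mem_HVset n t⟩ (singleton_mem_indepCx _ _)

/-- The vertex set of `X_t = G_{n,t} ∖ a_{t-1}`. -/
def XVset (n t : ℕ) : Set GV := GVset n t \ {GV.a (t-1)}

/-- The graph `X_t = G_{n,t} ∖ a_{t-1}`. -/
def lineX (n t : ℕ) : SimpleGraph (XVset n t) := (gFull n).induce (XVset n t)

/-- The vertex set of `Y_t = X_t ∖ a_{t-2}`. -/
def YVset (n t : ℕ) : Set GV := XVset n t \ {GV.a (t-2)}

/-- The graph `Y_t = X_t ∖ a_{t-2}`. -/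
def lineY (n t : ℕ) : SimpleGraph (YVset n t) := (gFull n).induce (YVset n t)

lemma a0_mem_XVset {n t : ℕ} (ht : 2 ≤ t) : GV.a 0 ∈ XVset n t := by
  refine ⟨a0_mem_GVset n t, fun h => ?_⟩
  rw [Set.mem_singleton_iff] at h
  injection h with h'
  omega

lemma a0_mem_YVset {n t : ℕ} (ht : 3 ≤ t) : GV.a 0 ∈ YVset n t := by
  refine ⟨a0_mem_XVset (by omega), fun h => ?_⟩
  rw [Set.mem_singleton_iff] at h
  injection h with h'
  omega

/-- The realization of `I(X_t)`, pointed at the vertex `a_0` (for `t ≥ 2`). -/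
noncomputable def IX (n t : ℕ) (ht : 2 ≤ t) : Ptd where
  carrier := geom (indepCx (lineX n t))
  pt := geomPt ⟨GV.a 0, a0_mem_XVset ht⟩ (singleton_mem_indepCx _ _)

/-- The realization of `I(Y_t)`, pointed at the vertex `a_0` (for `t ≥ 3`). -/
noncomputable def IY (n t : ℕ) (ht : 3 ≤ t) : Ptd where
  carrier := geom (indepCx (lineY n t))
  pt := geomPt ⟨GV.a 0, a0_mem_YVset ht⟩ (singleton_mem_indepCx _ _)

/-! ## The polygonal line tilings `P_{n,t}` themselves -/

/-- Ambient vertex names for the tiling `P_{n,t}`: `u i`/`v i` are the endpoints of the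
`i`-th shared (vertical) edge, and `p i j` / `q i j` are the intermediate vertices of
the top/bottom boundary path of the `i`-th polygon. -/
inductive PV : Type
  | u : ℕ → PV
  | v : ℕ → PV
  | p : ℕ → ℕ → PV
  | q : ℕ → ℕ → PV
deriving DecidableEq

/-- The base adjacency rules of the tiling `P_{n,t}` on the ambient vertex names. -/
def pRel (n : ℕ) : PV → PV → Prop
  | .u i, .v i' => i' = i
  | .u i, .u i' => i' = i + 1 ∧ n = 2
  | .v i, .v i' => i' = i + 1 ∧ n = 2
  | .u i, .p i' j => (i' = i + 1 ∧ j = 1) ∨ (i' = i ∧ j = n - 2)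
  | .v i, .q i' j => (i' = i + 1 ∧ j = 1) ∨ (i' = i ∧ j = n - 2)
  | .p i j, .p i' j' => i' = i ∧ j' = j + 1
  | .q i j, .q i' j' => i' = i ∧ j' = j + 1
  | _, _ => False

/-- The graph on all ambient tiling vertex names. -/
def pFull (n : ℕ) : SimpleGraph PV := SimpleGraph.fromRel (pRel n)

/-- The vertex set of `P_{n,t}`. -/
def PVset (n t : ℕ) : Set PV :=
  {w | match w with
    | .u i => i ≤ t
    | .v i => i ≤ t
    | .p i j => 1 ≤ i ∧ i ≤ t ∧ 1 ≤ j ∧ j ≤ n - 2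
    | .q i j => 1 ≤ i ∧ i ≤ t ∧ 1 ≤ j ∧ j ≤ n - 2}

/-- The polygonal line tiling `P_{n,t}` of `t` `2n`-gons. -/
def polyP (n t : ℕ) : SimpleGraph (PVset n t) := (pFull n).induce (PVset n t)

local notation "𝕀" => unitInterval

/-! ## Pointed homotopy equivalences -/

lemma homotopicRel_of_map {X Y : Type} [TopologicalSpace X] [TopologicalSpace Y] {f g : C(X, Y)}
    {S : Set X} (H : X × 𝕀 → Y) (hH : Continuous H) (h0 : ∀ x, H (x, 0) = f x)
    (h1 : ∀ x, H (x, 1) = g x) (hS : ∀ x ∈ S, ∀ t, H (x, t) = f x) : f.HomotopicRel g S :=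
  ⟨{ toFun := fun p => H (p.2, p.1)
     continuous_toFun := hH.comp continuous_swap
     map_zero_left := h0
     map_one_left := h1
     prop' := fun t x hx => hS x hx t }⟩

lemma homotopicRel_comp_right {X Y Z : Type} [TopologicalSpace X] [TopologicalSpace Y]
    [TopologicalSpace Z] {f g : C(Y, Z)} {S : Set Y} (h : f.HomotopicRel g S) (k : C(X, Y))
    {T : Set X} (hk : ∀ x ∈ T, k x ∈ S) : (f.comp k).HomotopicRel (g.comp k) T := by
  obtain ⟨H⟩ := h
  refine homotopicRel_of_map (fun p => H (p.2, k p.1)) (by fun_prop) (fun x => by simp)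
    (fun x => by simp) fun x hx t => ?_
  exact H.eq_fst t (hk x hx)

/-- Pointed homotopy equivalence of pointed spaces. -/
def Ptd.Equiv (X Y : Ptd) : Prop :=
  ∃ (f : C(X.carrier, Y.carrier)) (g : C(Y.carrier, X.carrier)),
    f X.pt = Y.pt ∧ g Y.pt = X.pt ∧
    (g.comp f).HomotopicRel (ContinuousMap.id _) {X.pt} ∧
    (f.comp g).HomotopicRel (ContinuousMap.id _) {Y.pt}

namespace Ptd.Equiv

variable {X Y Z : Ptd}

lemma of_inverse {f : X.carrier → Y.carrier} {g : Y.carrier → X.carrier} (hf : Continuous f)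
    (hg : Continuous g) (hpt : f X.pt = Y.pt) (hgf : ∀ x, g (f x) = x) (hfg : ∀ y, f (g y) = y) :
    X.Equiv Y := by
  refine ⟨⟨f, hf⟩, ⟨g, hg⟩, hpt, by simp [← hpt, hgf], ?_, ?_⟩
  · convert ContinuousMap.HomotopicRel.refl _
    ext x; exact (hgf x).symm
  · convert ContinuousMap.HomotopicRel.refl _
    ext x; exact (hfg x).symm

lemma refl (X : Ptd) : X.Equiv X :=
  of_inverse continuous_id continuous_id rfl (fun _ => rfl) fun _ => rfl

lemma symm (h : X.Equiv Y) : Y.Equiv X := by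
  obtain ⟨f, g, hf, hg, h1, h2⟩ := h
  exact ⟨g, f, hg, hf, h2, h1⟩

lemma trans (h : X.Equiv Y) (h' : Y.Equiv Z) : X.Equiv Z := by
  obtain ⟨f, g, hf, hg, h1, h2⟩ := h
  obtain ⟨f', g', hf', hg', h1', h2'⟩ := h'
  refine ⟨f'.comp f, g.comp g', by simp [hf, hf'], by simp [hg, hg'], ?_, ?_⟩
  · have := (homotopicRel_comp_right h1' f (T := {X.pt}) (by simp [hf])).comp_continuousMap g
    exact this.trans h1
  · have := (homotopicRel_comp_right h2 g' (T := {Z.pt}) (by simp [hg'])).comp_continuousMap f'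
    exact this.trans h2'

lemma homotopyEquiv (h : X.Equiv Y) :
    Nonempty (ContinuousMap.HomotopyEquiv X.carrier Y.carrier) := by
  obtain ⟨f, g, -, -, h1, h2⟩ := h
  exact ⟨⟨f, g, h1.homotopic, h2.homotopic⟩⟩

end Ptd.Equiv

/-! ## Quotients of disjoint unions -/

lemma Quot.continuous_prod {A Z W : Type} [TopologicalSpace A] [TopologicalSpace Z]
    [TopologicalSpace W] [LocallyCompactSpace W] {r : A → A → Prop} (G : Quot r × W → Z)
    (h : Continuous fun p : A × W => G (Quot.mk r p.1, p.2)) : Continuous G :=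
  isQuotientMap_quot_mk.continuous_lift_prod_left h

lemma Quot.continuous_sum_prod {A B Z W : Type} [TopologicalSpace A] [TopologicalSpace B]
    [TopologicalSpace Z] [TopologicalSpace W] [LocallyCompactSpace W]
    {r : A ⊕ B → A ⊕ B → Prop} (G : Quot r × W → Z)
    (h₁ : Continuous fun p : A × W => G (Quot.mk r (Sum.inl p.1), p.2))
    (h₂ : Continuous fun p : B × W => G (Quot.mk r (Sum.inr p.1), p.2)) : Continuous G := by
  refine Quot.continuous_prod G ?_
  have : (fun p : (A ⊕ B) × W => G (Quot.mk r p.1, p.2)) =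
      (Sum.elim (fun p : A × W => G (Quot.mk r (Sum.inl p.1), p.2))
        (fun p : B × W => G (Quot.mk r (Sum.inr p.1), p.2))) ∘ Homeomorph.sumProdDistrib := by
    ext ⟨x | x, w⟩ <;> rfl
  rw [this]
  exact (h₁.sumElim h₂).comp (Homeomorph.continuous _)

lemma Quot.continuous_sum {A B Z : Type} [TopologicalSpace A] [TopologicalSpace B]
    [TopologicalSpace Z] {r : A ⊕ B → A ⊕ B → Prop} (G : Quot r → Z)
    (h₁ : Continuous fun a => G (Quot.mk r (Sum.inl a)))
    (h₂ : Continuous fun b => G (Quot.mk r (Sum.inr b))) : Continuous G := by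
  refine isQuotientMap_quot_mk.continuous_iff.2 ?_
  convert h₁.sumElim h₂ using 1
  ext (x | x) <;> rfl

/-! ## Mapping cones -/

section MappingCone

variable {X Y : Type} [TopologicalSpace X] [TopologicalSpace Y]

/-- The gluing relation of the mapping cone: `X × {0}` is collapsed and `(x, 1)` is glued to
`f x`. -/
inductive MappingCone.Rel (f : C(X, Y)) : (X × 𝕀) ⊕ Y → (X × 𝕀) ⊕ Y → Prop
  | apex (x x' : X) : Rel f (Sum.inl (x, 0)) (Sum.inl (x', 0))
  | base (x : X) : Rel f (Sum.inl (x, 1)) (Sum.inr (f x))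

/-- The mapping cone of a map out of a nonempty space. -/
def MappingCone (f : C(X, Y)) : Type := Quot (MappingCone.Rel f)

instance (f : C(X, Y)) : TopologicalSpace (MappingCone f) :=
  inferInstanceAs (TopologicalSpace (Quot _))

namespace MappingCone

variable {f g : C(X, Y)}

/-- A point of the cone part of the mapping cone. -/
def cyl (f : C(X, Y)) (x : X) (s : 𝕀) : MappingCone f := Quot.mk _ (Sum.inl (x, s))

/-- The inclusion of the target into the mapping cone. -/
def inr (f : C(X, Y)) (y : Y) : MappingCone f := Quot.mk _ (Sum.inr y)

lemma cyl_zero (x x' : X) : cyl f x 0 = cyl f x' 0 := Quot.sound (.apex x x')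

lemma cyl_one (x : X) : cyl f x 1 = inr f (f x) := Quot.sound (.base x)

lemma continuous_cyl : Continuous fun p : X × 𝕀 => cyl f p.1 p.2 :=
  continuous_quot_mk.comp continuous_inl

lemma continuous_inr : Continuous (inr f) := continuous_quot_mk.comp _root_.continuous_inr

/-- Maps out of the mapping cone. -/
def desc {Z : Type} (h : X → 𝕀 → Z) (k : Y → Z) (h0 : ∀ x x', h x 0 = h x' 0)
    (h1 : ∀ x, h x 1 = k (f x)) : MappingCone f → Z :=
  Quot.lift (Sum.elim (fun p => h p.1 p.2) k) (by
    rintro _ _ (⟨x, x'⟩ | x)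
    · exact h0 x x'
    · exact h1 x)

lemma ind {P : MappingCone f → Prop} (hc : ∀ x s, P (cyl f x s)) (hr : ∀ y, P (inr f y)) :
    ∀ z, P z := by
  rintro ⟨⟨x, s⟩ | y⟩
  exacts [hc x s, hr y]

lemma continuous_of {Z : Type} [TopologicalSpace Z] {G : MappingCone f → Z}
    (h₁ : Continuous fun p : X × 𝕀 => G (cyl f p.1 p.2))
    (h₂ : Continuous fun y => G (inr f y)) : Continuous G :=
  Quot.continuous_sum G h₁ h₂

lemma continuous_prod {Z : Type} [TopologicalSpace Z] {G : MappingCone f × 𝕀 → Z}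
    (h₁ : Continuous fun p : (X × 𝕀) × 𝕀 => G (cyl f p.1.1 p.1.2, p.2))
    (h₂ : Continuous fun p : Y × 𝕀 => G (inr f p.1, p.2)) : Continuous G :=
  Quot.continuous_sum_prod G h₁ h₂

/-- The mapping cone, pointed at a point of the target. -/
abbrev ptd (f : C(X, Y)) (y : Y) : Ptd := { carrier := MappingCone f, pt := inr f y }

/-- The point of the mapping cone of `f` at height `θ` along the cylinder over `x`, continued past
height `1` along the track of a homotopy starting at `f`. -/
noncomputable def track (H : f.Homotopy g) (x : X) (θ : ℝ) : MappingCone f :=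
  if θ ≤ 1 then cyl f x (Set.projIcc 0 1 zero_le_one θ)
  else inr f (H (Set.projIcc 0 1 zero_le_one (θ - 1), x))

lemma track_of_le (H : f.Homotopy g) (x : X) {θ : ℝ} (h : θ ≤ 1) :
    track H x θ = cyl f x (Set.projIcc 0 1 zero_le_one θ) := if_pos h

lemma track_of_ge (H : f.Homotopy g) (x : X) {θ : ℝ} (h : 1 ≤ θ) :
    track H x θ = inr f (H (Set.projIcc 0 1 zero_le_one (θ - 1), x)) := by
  rcases h.eq_or_lt with rfl | h
  · rw [track_of_le H x le_rfl, Set.projIcc_right]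
    simp only [sub_self, Set.projIcc_left]
    exact (cyl_one x).trans (by congr 1; exact (H.apply_zero x).symm)
  · exact if_neg h.not_ge

lemma track_one (H : f.Homotopy g) (x : X) : track H x 1 = inr f (f x) := by
  rw [track_of_le H x le_rfl, Set.projIcc_right]; exact cyl_one x

lemma continuous_track (H : f.Homotopy g) : Continuous fun p : X × ℝ => track H p.1 p.2 := by
  have h1 : Continuous fun p : X × ℝ => cyl f p.1 (Set.projIcc 0 1 zero_le_one p.2) :=
    continuous_cyl.comp (continuous_fst.prodMk
      ((continuous_projIcc (h := zero_le_one (α := ℝ))).comp continuous_snd))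
  have h2 : Continuous fun p : X × ℝ =>
      inr f (H (Set.projIcc 0 1 zero_le_one (p.2 - 1), p.1)) :=
    continuous_inr.comp (H.continuous.comp
      (((continuous_projIcc (h := zero_le_one (α := ℝ))).comp
        (continuous_snd.sub continuous_const)).prodMk continuous_fst))
  refine Continuous.if_le h1 h2 continuous_snd continuous_const fun p hp => ?_
  exact (track_of_le H p.1 hp.le).symm.trans (track_of_ge H p.1 hp.ge)

/-- The map of mapping cones induced by a homotopy. -/
noncomputable def ofHomotopy (H : f.Homotopy g) : C(MappingCone g, MappingCone f) where
  toFun := desc (fun x s => track H x (2 * s)) (inr f)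
    (fun x x' => by
      simp only [Set.Icc.coe_zero, mul_zero]
      rw [track_of_le H x zero_le_one, track_of_le H x' zero_le_one, Set.projIcc_left]
      exact cyl_zero x x')
    (fun x => by
      rw [track_of_ge H x (by norm_num)]
      norm_num)
  continuous_toFun := continuous_of
    ((continuous_track H).comp (by fun_prop : Continuous fun p : X × 𝕀 => (p.1, 2 * (p.2 : ℝ))))
    continuous_inr

lemma ofHomotopy_symm (H : f.Homotopy g) (x : X) (s : 𝕀) :
    ofHomotopy H (ofHomotopy H.symm (cyl f x s)) =
      track H x (min (4 * (s : ℝ)) (3 - 2 * (s : ℝ))) := by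
  change ofHomotopy H (track H.symm x (2 * s)) = _
  rcases le_total (2 * (s : ℝ)) 1 with h | h
  · rw [track_of_le _ _ h, min_eq_left (by linarith)]
    change track H x (2 * (Set.projIcc 0 1 zero_le_one (2 * (s : ℝ)) : 𝕀)) = _
    rw [Set.projIcc_of_mem _ ⟨by linarith [s.2.1], h⟩]
    congr 1
    change 2 * (2 * (s : ℝ)) = _
    ring
  · rw [track_of_ge _ _ h, min_eq_right (by linarith), track_of_ge H x (by linarith [s.2.2])]
    change inr f _ = _
    congr 1
    rw [ContinuousMap.Homotopy.symm_apply]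
    congr 2
    have h2 := s.2.2
    rw [Set.projIcc_of_mem _ ⟨by linarith, by linarith⟩,
      Set.projIcc_of_mem _ ⟨by linarith, by linarith⟩]
    ext
    simp only [unitInterval.coe_symm_eq]
    ring

lemma ofHomotopy_comp_symm (H : f.Homotopy g) (y : Y) :
    ((ofHomotopy H).comp (ofHomotopy H.symm)).HomotopicRel (ContinuousMap.id _) {inr f y} := by
  refine homotopicRel_of_map (fun p => desc
    (fun x s => track H x ((1 - p.2) * min (4 * (s : ℝ)) (3 - 2 * (s : ℝ)) + p.2 * (s : ℝ))) (inr f) ?_ ?_ p.1)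
    ?_ ?_ ?_ ?_
  · intro x x'
    rw [show ((1 - p.2 : ℝ) * min (4 * ((0 : 𝕀) : ℝ)) (3 - 2 * ((0 : 𝕀) : ℝ)) + p.2 * ((0 : 𝕀) : ℝ) : ℝ) = 0 by
      simp]
    rw [track_of_le H x zero_le_one, track_of_le H x' zero_le_one, Set.projIcc_left]
    exact cyl_zero x x'
  · intro x
    rw [show ((1 - p.2 : ℝ) * min (4 * ((1 : 𝕀) : ℝ)) (3 - 2 * ((1 : 𝕀) : ℝ)) + p.2 * ((1 : 𝕀) : ℝ) : ℝ) = 1 by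
      norm_num]
    exact track_one H x
  · refine continuous_prod ?_ (continuous_inr.comp continuous_fst)
    exact (continuous_track H).comp (by fun_prop : Continuous fun p : (X × 𝕀) × 𝕀 =>
      (p.1.1, (1 - (p.2 : ℝ)) * min (4 * (p.1.2 : ℝ)) (3 - 2 * p.1.2) + p.2 * p.1.2))
  · refine ind (fun x s => ?_) fun y => rfl
    rw [ContinuousMap.comp_apply, ofHomotopy_symm]
    change track H x _ = _
    simp
  · refine ind (fun x s => ?_) fun y => rfl
    change track H x _ = cyl f x s
    simp only [Set.Icc.coe_one, sub_self, zero_mul, one_mul, zero_add]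
    rw [track_of_le H x s.2.2, Set.projIcc_val]
  · rintro _ rfl t
    rfl

/-- Homotopic maps have pointed homotopy equivalent mapping cones. -/
lemma equiv_of_homotopy (H : f.Homotopy g) (y : Y) : (ptd f y).Equiv (ptd g y) := by
  refine ⟨ofHomotopy H.symm, ofHomotopy H, rfl, rfl, ofHomotopy_comp_symm H y, ?_⟩
  have := ofHomotopy_comp_symm H.symm y
  rwa [ContinuousMap.Homotopy.symm_symm] at this

end MappingCone

end MappingCone

/-! ## Wedges and suspension wedges -/

namespace Ptd

namespace wedge

variable {X Y : Ptd}

/-- The first inclusion into a wedge. -/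
def inl (X Y : Ptd) (x : X.carrier) : (X.wedge Y).carrier := Quot.mk _ (Sum.inl x)

/-- The second inclusion into a wedge. -/
def inr (X Y : Ptd) (y : Y.carrier) : (X.wedge Y).carrier := Quot.mk _ (Sum.inr y)

lemma inl_pt : inl X Y X.pt = (X.wedge Y).pt := rfl

lemma inr_pt : inr X Y Y.pt = (X.wedge Y).pt := Quot.sound (.inr (.inr ⟨rfl, rfl⟩))

lemma continuous_inl : Continuous (inl X Y) := continuous_quot_mk.comp _root_.continuous_inl

lemma continuous_inr : Continuous (inr X Y) := continuous_quot_mk.comp _root_.continuous_inr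

/-- Maps out of a wedge. -/
def desc {Z : Type} (h : X.carrier → Z) (k : Y.carrier → Z) (hk : h X.pt = k Y.pt) :
    (X.wedge Y).carrier → Z :=
  Quot.lift (Sum.elim h k) (by
    rintro _ _ (rfl | ⟨rfl, rfl⟩ | ⟨rfl, rfl⟩)
    exacts [rfl, hk, hk.symm])

lemma ind {P : (X.wedge Y).carrier → Prop} (hl : ∀ x, P (inl X Y x)) (hr : ∀ y, P (inr X Y y)) :
    ∀ z, P z := by
  rintro ⟨x | y⟩
  exacts [hl x, hr y]

lemma continuous_of {Z : Type} [TopologicalSpace Z] {G : (X.wedge Y).carrier → Z}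
    (h₁ : Continuous fun x => G (inl X Y x)) (h₂ : Continuous fun y => G (inr X Y y)) :
    Continuous G :=
  Quot.continuous_sum G h₁ h₂

lemma continuous_prod {Z : Type} [TopologicalSpace Z] {G : (X.wedge Y).carrier × 𝕀 → Z}
    (h₁ : Continuous fun p : X.carrier × 𝕀 => G (inl X Y p.1, p.2))
    (h₂ : Continuous fun p : Y.carrier × 𝕀 => G (inr X Y p.1, p.2)) : Continuous G :=
  Quot.continuous_sum_prod G h₁ h₂

/-- Functoriality of the wedge. -/
def map {X' Y' : Ptd} (f : C(X.carrier, X'.carrier)) (g : C(Y.carrier, Y'.carrier))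
    (hf : f X.pt = X'.pt) (hg : g Y.pt = Y'.pt) :
    C((X.wedge Y).carrier, (X'.wedge Y').carrier) where
  toFun := desc (fun x => inl X' Y' (f x)) (fun y => inr X' Y' (g y))
    (by rw [hf, hg, inl_pt, inr_pt])
  continuous_toFun := continuous_of (continuous_inl.comp f.continuous)
    (continuous_inr.comp g.continuous)

lemma map_id_homotopicRel {f : C(Y.carrier, Y.carrier)} (hf : f Y.pt = Y.pt)
    (h : f.HomotopicRel (ContinuousMap.id _) {Y.pt}) :
    (map (ContinuousMap.id X.carrier) f rfl hf).HomotopicRel (ContinuousMap.id _)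
      {(X.wedge Y).pt} := by
  obtain ⟨H⟩ := h
  have e : ∀ t, H (t, Y.pt) = Y.pt := fun t => (H.eq_fst t rfl).trans hf
  refine homotopicRel_of_map (fun p => desc (inl X Y) (fun y => inr X Y (H (p.2, y)))
    (by rw [e, inl_pt, inr_pt]) p.1) ?_ ?_ ?_ ?_
  · refine continuous_prod (continuous_inl.comp continuous_fst) ?_
    exact continuous_inr.comp (by fun_prop : Continuous fun p : Y.carrier × 𝕀 => H (p.2, p.1))
  · exact ind (fun _ => rfl) fun y => congrArg (inr X Y) (H.apply_zero y)
  · exact ind (fun _ => rfl) fun y => congrArg (inr X Y) (H.apply_one y)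
  · rintro _ rfl t
    rfl

lemma equiv_congr_right {Y' : Ptd} (hY : Y.Equiv Y') : (X.wedge Y).Equiv (X.wedge Y') := by
  obtain ⟨f, g, hf, hg, h1, h2⟩ := hY
  refine ⟨map (.id _) f rfl hf, map (.id _) g rfl hg, rfl, rfl, ?_, ?_⟩
  · convert map_id_homotopicRel (X := X) (by simp [hf, hg]) h1 using 1
    exact ContinuousMap.ext (ind (fun _ => rfl) fun _ => rfl)
  · convert map_id_homotopicRel (X := X) (by simp [hf, hg]) h2 using 1
    exact ContinuousMap.ext (ind (fun _ => rfl) fun _ => rfl)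

end wedge

/-- The points of `X × [0,1]` collapsed in the reduced suspension. -/
def IsBase (X : Ptd) (p : X.carrier × 𝕀) : Prop := p.2 = 0 ∨ p.2 = 1 ∨ p.1 = X.pt

/-- The points identified with the base point in `suspWedge`. -/
def suspWedge.IsBase (X Y : Ptd) : (X.carrier × 𝕀) ⊕ Y.carrier → Prop :=
  Sum.elim X.IsBase (· = Y.pt)

/-- The wedge of the reduced suspension of `X` with `Y`, as a single quotient. -/
def suspWedge (X Y : Ptd) : Ptd where
  carrier := Quot fun p q => suspWedge.IsBase X Y p ∧ suspWedge.IsBase X Y q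
  pt := Quot.mk _ (Sum.inr Y.pt)

namespace suspWedge

variable {X Y : Ptd}

/-- The image of a point of `X × [0,1]`. -/
def loop (X Y : Ptd) (x : X.carrier) (s : 𝕀) : (X.suspWedge Y).carrier :=
  Quot.mk _ (Sum.inl (x, s))

/-- The inclusion of the second wedge summand. -/
def inr (X Y : Ptd) (y : Y.carrier) : (X.suspWedge Y).carrier := Quot.mk _ (Sum.inr y)

lemma inr_pt : inr X Y Y.pt = (X.suspWedge Y).pt := rfl

lemma loop_of_isBase {x : X.carrier} {s : 𝕀} (h : X.IsBase (x, s)) :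
    loop X Y x s = (X.suspWedge Y).pt := Quot.sound ⟨h, rfl⟩

lemma loop_zero (x : X.carrier) : loop X Y x 0 = (X.suspWedge Y).pt :=
  loop_of_isBase (.inl rfl)

lemma loop_one (x : X.carrier) : loop X Y x 1 = (X.suspWedge Y).pt :=
  loop_of_isBase (.inr (.inl rfl))

lemma loop_pt (s : 𝕀) : loop X Y X.pt s = (X.suspWedge Y).pt :=
  loop_of_isBase (.inr (.inr rfl))

lemma continuous_loop : Continuous fun p : X.carrier × 𝕀 => loop X Y p.1 p.2 :=
  continuous_quot_mk.comp continuous_inl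

lemma continuous_inr : Continuous (inr X Y) := continuous_quot_mk.comp _root_.continuous_inr

/-- Maps out of `suspWedge`. -/
def desc {Z : Type} (h : X.carrier → 𝕀 → Z) (k : Y.carrier → Z)
    (hk : ∀ x s, X.IsBase (x, s) → h x s = k Y.pt) : (X.suspWedge Y).carrier → Z :=
  Quot.lift (Sum.elim (fun p => h p.1 p.2) k) (by
    have key : ∀ p, IsBase X Y p → Sum.elim (fun p => h p.1 p.2) k p = k Y.pt := by
      rintro (⟨x, s⟩ | y) hp
      · exact hk x s hp
      · exact congrArg k hp
    intro p q hpq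
    rw [key p hpq.1, key q hpq.2])

lemma ind {P : (X.suspWedge Y).carrier → Prop} (hc : ∀ x s, P (loop X Y x s))
    (hr : ∀ y, P (inr X Y y)) : ∀ z, P z := by
  rintro ⟨⟨x, s⟩ | y⟩
  exacts [hc x s, hr y]

lemma continuous_of {Z : Type} [TopologicalSpace Z] {G : (X.suspWedge Y).carrier → Z}
    (h₁ : Continuous fun p : X.carrier × 𝕀 => G (loop X Y p.1 p.2))
    (h₂ : Continuous fun y => G (inr X Y y)) : Continuous G :=
  Quot.continuous_sum G h₁ h₂

lemma continuous_prod {Z : Type} [TopologicalSpace Z] {G : (X.suspWedge Y).carrier × 𝕀 → Z}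
    (h₁ : Continuous fun p : (X.carrier × 𝕀) × 𝕀 => G (loop X Y p.1.1 p.1.2, p.2))
    (h₂ : Continuous fun p : Y.carrier × 𝕀 => G (inr X Y p.1, p.2)) : Continuous G :=
  Quot.continuous_sum_prod G h₁ h₂

variable {X' Y' : Ptd}

lemma _root_.Ptd.IsBase.map {f : X.carrier → X'.carrier} (hf : f X.pt = X'.pt) {x : X.carrier}
    {s : 𝕀} (h : X.IsBase (x, s)) : X'.IsBase (f x, s) := by
  rcases h with h | h | rfl
  exacts [.inl h, .inr (.inl h), .inr (.inr hf)]

/-- Functoriality of `suspWedge`. -/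
def map (f : C(X.carrier, X'.carrier)) (g : C(Y.carrier, Y'.carrier)) (hf : f X.pt = X'.pt)
    (hg : g Y.pt = Y'.pt) : C((X.suspWedge Y).carrier, (X'.suspWedge Y').carrier) where
  toFun := desc (fun x s => loop X' Y' (f x) s) (fun y => inr X' Y' (g y)) (by
    intro x s h
    rw [hg, loop_of_isBase (h.map hf), inr_pt])
  continuous_toFun := continuous_of (continuous_loop.comp (by fun_prop :
    Continuous fun p : X.carrier × 𝕀 => (f p.1, p.2))) (continuous_inr.comp g.continuous)

lemma map_homotopicRel {f f' : C(X.carrier, X.carrier)} {g g' : C(Y.carrier, Y.carrier)}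
    (hf : f X.pt = X.pt) (hf' : f' X.pt = X.pt) (hg : g Y.pt = Y.pt) (hg' : g' Y.pt = Y.pt)
    (h : f.HomotopicRel f' {X.pt}) (h' : g.HomotopicRel g' {Y.pt}) :
    (map f g hf hg).HomotopicRel (map f' g' hf' hg') {(X.suspWedge Y).pt} := by
  obtain ⟨H⟩ := h
  obtain ⟨H'⟩ := h'
  have e : ∀ t, H (t, X.pt) = X.pt := fun t => (H.eq_fst t rfl).trans hf
  have e' : ∀ t, H' (t, Y.pt) = Y.pt := fun t => (H'.eq_fst t rfl).trans hg
  refine homotopicRel_of_map (fun p => desc (fun x s => loop X Y (H (p.2, x)) s)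
    (fun y => inr X Y (H' (p.2, y))) ?_ p.1) ?_ ?_ ?_ ?_
  · intro x s hs
    rw [e', inr_pt]
    exact loop_of_isBase (hs.map (f := fun x => H (p.2, x)) (e p.2))
  · refine continuous_prod ?_ ?_
    · exact continuous_loop.comp (by fun_prop :
        Continuous fun p : (X.carrier × 𝕀) × 𝕀 => (H (p.2, p.1.1), p.1.2))
    · exact continuous_inr.comp (by fun_prop :
        Continuous fun p : Y.carrier × 𝕀 => H' (p.2, p.1))
  · refine ind (fun x s => ?_) fun y => ?_
    · exact congrArg (loop X Y · s) (H.apply_zero x)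
    · exact congrArg (inr X Y) (H'.apply_zero y)
  · refine ind (fun x s => ?_) fun y => ?_
    · exact congrArg (loop X Y · s) (H.apply_one x)
    · exact congrArg (inr X Y) (H'.apply_one y)
  · rintro _ rfl t
    change inr X Y (H' (t, Y.pt)) = inr X Y (g Y.pt)
    rw [e', hg]

lemma map_id : map (ContinuousMap.id X.carrier) (ContinuousMap.id Y.carrier) rfl rfl =
    ContinuousMap.id _ :=
  ContinuousMap.ext (ind (fun _ _ => rfl) fun _ => rfl)

lemma map_comp_map_homotopicRel {f : C(X.carrier, X'.carrier)} {g : C(Y.carrier, Y'.carrier)}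
    {f' : C(X'.carrier, X.carrier)} {g' : C(Y'.carrier, Y.carrier)} (hf : f X.pt = X'.pt)
    (hg : g Y.pt = Y'.pt) (hf' : f' X'.pt = X.pt) (hg' : g' Y'.pt = Y.pt)
    (h : (f'.comp f).HomotopicRel (ContinuousMap.id _) {X.pt})
    (h' : (g'.comp g).HomotopicRel (ContinuousMap.id _) {Y.pt}) :
    ((map f' g' hf' hg').comp (map f g hf hg)).HomotopicRel (ContinuousMap.id _)
      {(X.suspWedge Y).pt} := by
  have := map_homotopicRel (by simp [hf, hf']) rfl (by simp [hg, hg']) rfl h h'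
  rw [map_id] at this
  convert this using 1
  exact ContinuousMap.ext (ind (fun _ _ => rfl) fun _ => rfl)

lemma equiv_congr (hX : X.Equiv X') (hY : Y.Equiv Y') :
    (X.suspWedge Y).Equiv (X'.suspWedge Y') := by
  obtain ⟨f, f', hf, hf', h1, h2⟩ := hX
  obtain ⟨g, g', hg, hg', h1', h2'⟩ := hY
  exact ⟨map f g hf hg, map f' g' hf' hg', congrArg (inr X' Y') hg, congrArg (inr X Y) hg',
    map_comp_map_homotopicRel _ _ _ _ h1 h1', map_comp_map_homotopicRel _ _ _ _ h2 h2'⟩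

lemma point_equiv : (Ptd.point.suspWedge Y).Equiv Y := by
  refine Equiv.of_inverse (f := desc (fun _ _ => Y.pt) id fun _ _ _ => rfl) (g := inr _ Y)
    (continuous_of continuous_const continuous_id) continuous_inr rfl ?_ fun _ => rfl
  exact ind (fun x s => (loop_pt s).symm) fun _ => rfl

/-- If `S` is the reduced suspension of `A` via `q`, the suspension wedge of `A ∨ B` and `Y`
splits off `S`. -/
lemma wedge_equiv {A B S : Ptd} {q : C(A.carrier × 𝕀, S.carrier)} (hq : Topology.IsQuotientMap q)
    (hbase : ∀ p, A.IsBase p → q p = S.pt)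
    (hker : ∀ p p', q p = q p' → p = p' ∨ A.IsBase p ∧ A.IsBase p') :
    ((A.wedge B).suspWedge Y).Equiv (S.wedge (B.suspWedge Y)) := by
  set W := S.wedge (B.suspWedge Y)
  set U := (A.wedge B).suspWedge Y
  let e : (A.wedge B).carrier → 𝕀 → W.carrier := fun w s =>
    wedge.desc (fun a => wedge.inl S (B.suspWedge Y) (q (a, s)))
      (fun b => wedge.inr S (B.suspWedge Y) (loop B Y b s))
      (by rw [loop_pt, wedge.inr_pt, hbase _ (.inr (.inr rfl)), wedge.inl_pt]) w
  have he : ∀ w s, (A.wedge B).IsBase (w, s) → e w s = W.pt := by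
    intro w s h
    rcases h with h | h | h
    · obtain rfl : s = 0 := h
      revert w
      refine wedge.ind (fun a => ?_) fun b => ?_
      · exact (congrArg _ (hbase _ (.inl rfl))).trans wedge.inl_pt
      · exact (congrArg _ (loop_zero b)).trans wedge.inr_pt
    · obtain rfl : s = 1 := h
      revert w
      refine wedge.ind (fun a => ?_) fun b => ?_
      · exact (congrArg _ (hbase _ (.inr (.inl rfl)))).trans wedge.inl_pt
      · exact (congrArg _ (loop_one b)).trans wedge.inr_pt
    · obtain rfl : w = _ := h
      exact (congrArg _ (hbase _ (.inr (.inr rfl)))).trans wedge.inl_pt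
  let F : U.carrier → W.carrier :=
    desc e (fun y => wedge.inr S (B.suspWedge Y) (inr B Y y)) (by
      intro w s h
      rw [he w s h, inr_pt, wedge.inr_pt])
  have hF : Continuous F := by
    refine continuous_of ?_ (wedge.continuous_inr.comp continuous_inr)
    exact wedge.continuous_prod (G := fun p => e p.1 p.2)
      (wedge.continuous_inl.comp hq.continuous) (wedge.continuous_inr.comp continuous_loop)
  let j : C(A.carrier × 𝕀, U.carrier) :=
    ⟨fun p => loop _ Y (wedge.inl A B p.1) p.2, continuous_loop.comp
      ((wedge.continuous_inl.comp continuous_fst).prodMk continuous_snd)⟩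
  have hj : ∀ p, A.IsBase p → j p = U.pt := fun p hp =>
    loop_of_isBase (IsBase.map (X' := A.wedge B) (f := wedge.inl A B) rfl hp)
  have hjq : Function.FactorsThrough j q := by
    intro p p' h
    rcases hker p p' h with rfl | ⟨h1, h2⟩
    · rfl
    · rw [hj p h1, hj p' h2]
  let k := hq.lift j hjq
  have hk : ∀ p, k (q p) = j p := fun p => DFunLike.congr_fun (hq.lift_comp j hjq) p
  have hkpt : k S.pt = U.pt := by
    rw [← hbase (A.pt, 0) (.inl rfl), hk]
    exact hj _ (.inl rfl)
  let G : W.carrier → U.carrier := wedge.desc k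
    (desc (fun b s => loop _ Y (wedge.inr A B b) s) (inr _ Y) (by
      intro b s h
      rw [inr_pt]
      exact loop_of_isBase (IsBase.map (X' := A.wedge B) wedge.inr_pt h))) hkpt
  have hG : Continuous G := by
    refine wedge.continuous_of k.continuous (continuous_of ?_ continuous_inr)
    exact continuous_loop.comp
      ((wedge.continuous_inr.comp continuous_fst).prodMk continuous_snd)
  refine Equiv.of_inverse hF hG wedge.inr_pt ?_ ?_
  · refine ind (fun w s => ?_) fun _ => rfl
    revert w
    exact wedge.ind (fun a => hk (a, s)) fun b => rfl
  · refine wedge.ind (fun z => ?_) (ind (fun b s => rfl) fun _ => rfl)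
    obtain ⟨p, rfl⟩ := hq.surjective z
    exact congrArg F (hk p)

end suspWedge

/-- Data exhibiting the base point as nondegenerate: a deformation `r` which at time `1` collapses
the locus `u < 1` to the base point. -/
structure Collar (X : Ptd) where
  r : X.carrier × 𝕀 → X.carrier
  u : X.carrier → ℝ
  continuous_r : Continuous r
  continuous_u : Continuous u
  r_zero : ∀ x, r (x, 0) = x
  r_pt : ∀ t, r (X.pt, t) = X.pt
  u_nonneg : ∀ x, 0 ≤ u x
  u_le : ∀ x, u x ≤ 1
  u_pt : u X.pt = 0
  r_one : ∀ x, u x < 1 → r (x, 1) = X.pt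

end Ptd

namespace MappingCone

open Ptd

variable {X Y : Ptd}

/-- The constant map between pointed spaces. -/
abbrev trivialMap (X Y : Ptd) : C(X.carrier, Y.carrier) := ContinuousMap.const _ Y.pt

/-- The quotient map from the cone of the constant map to the suspension wedge. -/
def toSuspWedge (X Y : Ptd) : C(MappingCone (trivialMap X Y), (X.suspWedge Y).carrier) where
  toFun := desc (suspWedge.loop X Y) (suspWedge.inr X Y)
    (fun x x' => by rw [suspWedge.loop_zero, suspWedge.loop_zero])
    (fun x => suspWedge.loop_one x)
  continuous_toFun := continuous_of suspWedge.continuous_loop suspWedge.continuous_inr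

/-- The homotopy parametrizing the collapse of a cone line. -/
noncomputable def collapse (c : X.Collar) (Y : Ptd) (p : (X.carrier × 𝕀) × 𝕀) :
    MappingCone (trivialMap X Y) :=
  if 0 ≤ (1 + p.2 : ℝ) * p.1.2 - p.2 then
    cyl _ (c.r (p.1.1, 1)) (Set.projIcc 0 1 zero_le_one
      (max ((1 + p.2 : ℝ) * p.1.2 - p.2) (p.2 * (1 - c.u p.1.1))))
  else cyl _ X.pt (Set.projIcc 0 1 zero_le_one
      (max (-((1 + p.2 : ℝ) * p.1.2 - p.2)) (p.2 * (1 - c.u p.1.1))))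

lemma continuous_collapse (c : X.Collar) : Continuous (collapse c Y) := by
  have hr := c.continuous_r
  have hu := c.continuous_u
  have hp : Continuous (Set.projIcc (0 : ℝ) 1 zero_le_one) := continuous_projIcc
  refine Continuous.if_le ?_ ?_ continuous_const (by fun_prop) ?_
  · exact continuous_cyl.comp (by fun_prop : Continuous fun p : (X.carrier × 𝕀) × 𝕀 =>
      (c.r (p.1.1, 1), Set.projIcc (0 : ℝ) 1 zero_le_one
      (max ((1 + p.2 : ℝ) * p.1.2 - p.2) (p.2 * (1 - c.u p.1.1)))))
  · exact continuous_cyl.comp (by fun_prop : Continuous fun p : (X.carrier × 𝕀) × 𝕀 =>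
      (X.pt, Set.projIcc (0 : ℝ) 1 zero_le_one
      (max (-((1 + p.2 : ℝ) * p.1.2 - p.2)) (p.2 * (1 - c.u p.1.1)))))
  · intro p hp
    rw [← hp, neg_zero]
    rcases (c.u_le p.1.1).lt_or_eq with h | h
    · rw [c.r_one _ h]
    · rw [h, sub_self, mul_zero, max_self, Set.projIcc_left]
      exact cyl_zero _ _

lemma collapse_bot (c : X.Collar) (x : X.carrier) (t : 𝕀) :
    collapse c Y ((x, 0), t) = cyl _ X.pt t := by
  have h1 : (t : ℝ) * (1 - c.u x) ≤ t := by nlinarith [t.2.1, c.u_nonneg x]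
  unfold collapse
  simp only [Set.Icc.coe_zero, mul_zero, zero_sub, neg_neg, max_eq_left h1, Set.projIcc_val]
  split_ifs with h
  · obtain rfl : t = 0 := Subtype.ext (le_antisymm (neg_nonneg.1 h) t.2.1)
    simp only [Set.Icc.coe_zero, neg_zero, zero_mul, max_self, Set.projIcc_left]
    exact cyl_zero _ _
  · rfl

lemma collapse_top (c : X.Collar) (x : X.carrier) (t : 𝕀) :
    collapse c Y ((x, 1), t) = inr _ Y.pt := by
  have h1 : (t : ℝ) * (1 - c.u x) ≤ 1 := by nlinarith [t.2.1, t.2.2, c.u_nonneg x]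
  unfold collapse
  simp only [Set.Icc.coe_one, mul_one, add_sub_cancel_right, zero_le_one, if_true, max_eq_left h1,
    Set.projIcc_right]
  exact cyl_one _

lemma collapse_pt (c : X.Collar) (s t : 𝕀) : ∃ s', collapse c Y ((X.pt, s), t) = cyl _ X.pt s' := by
  unfold collapse
  rw [c.r_pt]
  split_ifs
  exacts [⟨_, rfl⟩, ⟨_, rfl⟩]

lemma collapse_pt_one (c : X.Collar) (s : 𝕀) : collapse c Y ((X.pt, s), 1) = inr _ Y.pt := by
  have h1 := s.2.1
  have h2 := s.2.2
  unfold collapse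
  rw [c.r_pt, c.u_pt]
  simp only [Set.Icc.coe_one, sub_zero, mul_one]
  rw [max_eq_right (by linarith), max_eq_right (by linarith), Set.projIcc_right, ite_self]
  exact cyl_one _

lemma collapse_zero (c : X.Collar) (x : X.carrier) (s : 𝕀) :
    collapse c Y ((x, s), 0) = cyl _ (c.r (x, 1)) s := by
  unfold collapse
  simp only [Set.Icc.coe_zero, add_zero, one_mul, sub_zero, zero_mul, max_eq_left s.2.1,
    Set.projIcc_val]
  exact if_pos s.2.1

/-- The map from the suspension wedge to the cone of the constant map. -/
noncomputable def ofSuspWedge (c : X.Collar) (Y : Ptd) :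
    C((X.suspWedge Y).carrier, MappingCone (trivialMap X Y)) where
  toFun := suspWedge.desc (fun x s => collapse c Y ((x, s), 1)) (inr _) (by
    rintro x s (h | h | h)
    · obtain rfl : s = 0 := h
      rw [collapse_bot]
      exact cyl_one _
    · obtain rfl : s = 1 := h
      exact collapse_top c x 1
    · obtain rfl : x = X.pt := h
      exact collapse_pt_one c s)
  continuous_toFun := suspWedge.continuous_of
    ((continuous_collapse c).comp (by fun_prop :
      Continuous fun p : X.carrier × 𝕀 => ((p, 1) : (X.carrier × 𝕀) × 𝕀))) continuous_inr

/-- The self-map of the cone of the constant map induced by the end of the collar deformation. -/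
noncomputable def shrink (c : X.Collar) (Y : Ptd) :
    C(MappingCone (trivialMap X Y), MappingCone (trivialMap X Y)) where
  toFun := desc (fun x s => cyl _ (c.r (x, 1)) s) (inr _) (fun x x' => cyl_zero _ _)
    (fun x => cyl_one _)
  continuous_toFun := by
    have hr := c.continuous_r
    exact continuous_of (continuous_cyl.comp
      (by fun_prop : Continuous fun p : X.carrier × 𝕀 => (c.r (p.1, 1), p.2))) continuous_inr

/-- The self-map of the suspension wedge induced by the end of the collar deformation. -/
noncomputable def shrinkSusp (c : X.Collar) (Y : Ptd) :
    C((X.suspWedge Y).carrier, (X.suspWedge Y).carrier) :=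
  suspWedge.map ⟨fun x => c.r (x, 1), c.continuous_r.comp (by fun_prop)⟩ (ContinuousMap.id _)
    (c.r_pt 1) rfl

lemma ofSuspWedge_comp (c : X.Collar) :
    ((ofSuspWedge c Y).comp (toSuspWedge X Y)).HomotopicRel (ContinuousMap.id _)
      {inr _ Y.pt} := by
  have hr := c.continuous_r
  have h1 : (shrink c Y).HomotopicRel (ContinuousMap.id _) {inr _ Y.pt} := by
    refine (homotopicRel_of_map (fun p => desc (fun x s => cyl _ (c.r (x, p.2)) s) (inr _)
      (fun x x' => cyl_zero _ _) (fun x => cyl_one _) p.1) ?_ ?_ ?_ ?_).symm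
    · exact continuous_prod (continuous_cyl.comp (by fun_prop :
        Continuous fun p : (X.carrier × 𝕀) × 𝕀 => (c.r (p.1.1, p.2), p.1.2)))
        (continuous_inr.comp continuous_fst)
    · refine ind (fun x s => ?_) fun _ => rfl
      change cyl _ (c.r (x, 0)) s = cyl _ x s
      rw [c.r_zero]
    · exact ind (fun _ _ => rfl) fun _ => rfl
    · rintro _ rfl t
      rfl
  refine (homotopicRel_of_map (fun p => desc (fun x s => collapse c Y ((x, s), p.2)) (inr _)
    (fun x x' => ?_) (fun x => collapse_top c x _) p.1) ?_ ?_ ?_ ?_).symm.trans h1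
  · rw [collapse_bot, collapse_bot]
  · exact continuous_prod (continuous_collapse c) (continuous_inr.comp continuous_fst)
  · exact ind (fun x s => collapse_zero c x s) fun _ => rfl
  · exact ind (fun _ _ => rfl) fun _ => rfl
  · rintro _ rfl t
    rfl

lemma toSuspWedge_comp (c : X.Collar) :
    ((toSuspWedge X Y).comp (ofSuspWedge c Y)).HomotopicRel (ContinuousMap.id _)
      {(X.suspWedge Y).pt} := by
  have h1 : (shrinkSusp c Y).HomotopicRel (ContinuousMap.id _) {(X.suspWedge Y).pt} := by
    have := suspWedge.map_homotopicRel (Y := Y) (X := X) (f' := ContinuousMap.id _)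
      (g := ContinuousMap.id _) (c.r_pt 1) rfl rfl rfl
      (f := ⟨fun x => c.r (x, 1), c.continuous_r.comp (by fun_prop)⟩)
      (homotopicRel_of_map c.r c.continuous_r c.r_zero (fun x => rfl)
        (by rintro _ rfl t; exact c.r_pt t)).symm (.refl _)
    rw [suspWedge.map_id] at this
    exact this
  refine (homotopicRel_of_map (fun p => suspWedge.desc
    (fun x s => toSuspWedge X Y (collapse c Y ((x, s), p.2))) (suspWedge.inr X Y)
    (fun x s h => ?_) p.1) ?_ ?_ ?_ ?_).symm.trans h1
  · rcases h with h | h | h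
    · obtain rfl : s = 0 := h
      rw [collapse_bot]
      exact suspWedge.loop_pt _
    · obtain rfl : s = 1 := h
      rw [collapse_top]
      rfl
    · obtain rfl : x = X.pt := h
      obtain ⟨s', hs'⟩ := collapse_pt (Y := Y) c s p.2
      rw [hs']
      exact suspWedge.loop_pt _
  · exact suspWedge.continuous_prod ((toSuspWedge X Y).continuous.comp (continuous_collapse c))
      (suspWedge.continuous_inr.comp continuous_fst)
  · exact suspWedge.ind (fun x s => congrArg (toSuspWedge X Y) (collapse_zero c x s)) fun _ => rfl
  · exact suspWedge.ind (fun _ _ => rfl) fun _ => rfl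
  · rintro _ rfl t
    rfl

/-- The cone of a constant map out of a space with nondegenerate base point. -/
lemma equiv_suspWedge (c : X.Collar) (Y : Ptd) :
    (ptd (trivialMap X Y) Y.pt).Equiv (X.suspWedge Y) :=
  ⟨toSuspWedge X Y, ofSuspWedge c Y, rfl, rfl, ofSuspWedge_comp c, toSuspWedge_comp c⟩

end MappingCone

/-! ## Suspensions of spheres -/

section SphereSuspension

lemma exists_unitInterval_cos_sin {a b : ℝ} (h : a ^ 2 + b ^ 2 = 1) :
    ∃ s : 𝕀, Real.cos (2 * Real.pi * s) = a ∧ Real.sin (2 * Real.pi * s) = b := by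
  have hpi := Real.pi_pos
  have hz : ‖(⟨a, b⟩ : ℂ)‖ = 1 := by
    rw [Complex.norm_def, Complex.normSq_mk, ← sq, ← sq, h, Real.sqrt_one]
  have h0 : (⟨a, b⟩ : ℂ) ≠ 0 := by
    intro h0
    simp [h0] at hz
  have hc : Real.cos (Complex.arg ⟨a, b⟩) = a := by rw [Complex.cos_arg h0, hz, div_one]
  have hs : Real.sin (Complex.arg ⟨a, b⟩) = b := by rw [Complex.sin_arg, hz, div_one]
  have h1 := Complex.neg_pi_lt_arg ⟨a, b⟩
  have h2 := Complex.arg_le_pi ⟨a, b⟩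
  set θ := Complex.arg ⟨a, b⟩
  rcases le_total 0 θ with hθ | hθ
  · refine ⟨⟨θ / (2 * Real.pi), by positivity, (div_le_one (by positivity)).2 (by linarith)⟩, ?_⟩
    rw [show 2 * Real.pi * (θ / (2 * Real.pi)) = θ by field_simp]
    exact ⟨hc, hs⟩
  · refine ⟨⟨(θ + 2 * Real.pi) / (2 * Real.pi), div_nonneg (by linarith) (by linarith),
      (div_le_one (by positivity)).2 (by linarith)⟩, ?_⟩
    rw [show 2 * Real.pi * ((θ + 2 * Real.pi) / (2 * Real.pi)) = θ + 2 * Real.pi by field_simp,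
      Real.cos_add_two_pi, Real.sin_add_two_pi]
    exact ⟨hc, hs⟩

lemma unitInterval_eq_of_cos_sin {s s' : 𝕀} (hs : s ≠ 1) (hs' : s' ≠ 1)
    (hc : Real.cos (2 * Real.pi * s) = Real.cos (2 * Real.pi * s'))
    (hsin : Real.sin (2 * Real.pi * s) = Real.sin (2 * Real.pi * s')) : s = s' := by
  have hpi := Real.pi_pos
  have h1 : Real.cos (2 * Real.pi * s - 2 * Real.pi * s') = 1 := by
    rw [Real.cos_sub, hc, hsin, ← sq, ← sq, Real.cos_sq_add_sin_sq]
  have l : (s : ℝ) < 1 := lt_of_le_of_ne s.2.2 fun h => hs (Subtype.ext h)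
  have l' : (s' : ℝ) < 1 := lt_of_le_of_ne s'.2.2 fun h => hs' (Subtype.ext h)
  have h2 := (Real.cos_eq_one_iff_of_lt_of_lt (by nlinarith [s.2.1]) (by nlinarith [s'.2.1])).1 h1
  have h3 : 2 * Real.pi * ((s : ℝ) - s') = 0 := by linarith
  ext
  have := (mul_eq_zero.1 h3).resolve_left (by positivity)
  linarith

lemma cos_two_pi_mul_lt_one {s : 𝕀} (h0 : s ≠ 0) (h1 : s ≠ 1) :
    Real.cos (2 * Real.pi * s) < 1 := by
  refine lt_of_le_of_ne (Real.cos_le_one _) fun h => h0 ?_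
  refine unitInterval_eq_of_cos_sin h1 (by simp) (by simpa using h) ?_
  have := Real.sin_sq_add_cos_sq (2 * Real.pi * s)
  rw [h] at this
  simpa using this

variable {E : Type} [NormedAddCommGroup E] [InnerProductSpace ℝ E]

/-- The base coordinates of the standard map `S^k × [0,1] → S^(k+1)`. -/
noncomputable def suspBase (b x : E) (s : ℝ) : E :=
  x + ((1 + Real.cos (2 * Real.pi * s)) / 2) • (b - x)

/-- The height coordinate of the standard map `S^k × [0,1] → S^(k+1)`. -/
noncomputable def suspHeight (b x : E) (s : ℝ) : ℝ :=
  Real.sin (2 * Real.pi * s) * ‖b - x‖ / 2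

lemma norm_sub_sq_of_unit {b x : E} (hb : ‖b‖ = 1) (hx : ‖x‖ = 1) :
    ‖b - x‖ ^ 2 = 2 - 2 * inner ℝ b x := by
  rw [norm_sub_sq_real, hb, hx]; ring

lemma suspBase_sub (b x : E) (s : ℝ) :
    suspBase b x s - b = ((1 - Real.cos (2 * Real.pi * s)) / 2) • (x - b) := by
  unfold suspBase
  module

lemma norm_suspBase_sq_add {b x : E} (hb : ‖b‖ = 1) (hx : ‖x‖ = 1) (s : ℝ) :
    ‖suspBase b x s‖ ^ 2 + suspHeight b x s ^ 2 = 1 := by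
  have h := norm_sub_sq_of_unit hb hx
  have h2 := Real.sin_sq_add_cos_sq (2 * Real.pi * s)
  unfold suspBase suspHeight
  rw [norm_add_sq_real, norm_smul, mul_pow, inner_smul_right, inner_sub_right,
    real_inner_self_eq_norm_sq, hx, div_pow, mul_pow, h, Real.norm_eq_abs, sq_abs,
    real_inner_comm]
  linear_combination (inner ℝ b x - 1) * (-1 / 2) * h2

lemma eq_of_smul_sub_eq {b x x' : E} (hb : ‖b‖ = 1) (hx : ‖x‖ = 1) (hx' : ‖x'‖ = 1) (hxb : x ≠ b)
    {c c' : ℝ} (hc : c ≠ 0) (hc' : c' ≠ 0) (h : c • (x - b) = c' • (x' - b)) :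
    x = x' ∧ c = c' := by
  have e1 : ∀ {y : E} {d : ℝ}, ‖y‖ = 1 →
      2 * d * inner ℝ b (d • (y - b)) + ‖d • (y - b)‖ ^ 2 = 0 := by
    intro y d hy
    rw [norm_smul, mul_pow, inner_smul_right, inner_sub_right, norm_sub_rev,
      norm_sub_sq_of_unit hb hy, real_inner_self_eq_norm_sq, hb, Real.norm_eq_abs, sq_abs]
    ring
  have h1 := e1 (d := c) hx
  have h2 := e1 (d := c') hx'
  rw [← h] at h2
  have hw : ‖c • (x - b)‖ ^ 2 ≠ 0 := by
    simpa using ⟨hc, sub_ne_zero.2 hxb⟩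
  have hw' : (inner ℝ b (c • (x - b)) : ℝ) ≠ 0 := by
    intro h0
    rw [h0] at h1
    exact hw (by linarith)
  have hcc : c = c' := by
    have : (inner ℝ b (c • (x - b)) : ℝ) * (c - c') = 0 := by linear_combination (h1 - h2) / 2
    have := (mul_eq_zero.1 this).resolve_left hw'
    linarith
  subst hcc
  have := smul_right_injective E hc h
  exact ⟨sub_left_injective this, rfl⟩

lemma susp_ker {b x x' : E} (hb : ‖b‖ = 1) (hx : ‖x‖ = 1) (hx' : ‖x'‖ = 1) {s s' : 𝕀}
    (h1 : suspBase b x s = suspBase b x' s') (h2 : suspHeight b x s = suspHeight b x' s') :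
    (x = x' ∧ s = s') ∨ (s = 0 ∨ s = 1 ∨ x = b) ∧ (s' = 0 ∨ s' = 1 ∨ x' = b) := by
  have key : ∀ {y : E} {r : 𝕀}, (r = 0 ∨ r = 1 ∨ y = b) ↔
      (suspBase b y r = b ) := by
    intro y r
    rw [← sub_eq_zero (a := suspBase b y r), suspBase_sub, smul_eq_zero, sub_eq_zero]
    constructor
    · rintro (rfl | rfl | rfl) <;> simp
    · rintro (h | h)
      · by_contra! h'
        have := cos_two_pi_mul_lt_one h'.1 h'.2.1
        linarith
      · exact .inr (.inr h)
  by_cases hbad : s = 0 ∨ s = 1 ∨ x = b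
  · exact .inr ⟨hbad, key.2 (h1 ▸ key.1 hbad)⟩
  have hbad' : ¬ (s' = 0 ∨ s' = 1 ∨ x' = b) := fun h => hbad (key.2 (h1 ▸ key.1 h))
  push Not at hbad hbad'
  left
  have l := cos_two_pi_mul_lt_one hbad.1 hbad.2.1
  have l' := cos_two_pi_mul_lt_one hbad'.1 hbad'.2.1
  obtain ⟨rfl, hc⟩ := eq_of_smul_sub_eq hb hx hx' hbad.2.2 (by linarith) (by linarith)
    ((suspBase_sub b x s).symm.trans ((congrArg (· - b) h1).trans (suspBase_sub b x' s')))
  refine ⟨rfl, unitInterval_eq_of_cos_sin hbad.2.1 hbad'.2.1 (by linarith) ?_⟩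
  have hn : ‖b - x‖ ≠ 0 := norm_ne_zero_iff.2 (sub_ne_zero.2 hbad.2.2.symm)
  unfold suspHeight at h2
  exact mul_right_cancel₀ hn (by linarith)

lemma susp_surj {b z : E} {h : ℝ} (hb : ‖b‖ = 1) (hz : ‖z‖ ^ 2 + h ^ 2 = 1) :
    ∃ (x : E) (s : 𝕀), ‖x‖ = 1 ∧ suspBase b x s = z ∧ suspHeight b x s = h := by
  by_cases hzb : z = b
  · subst hzb
    have : h = 0 := by simpa [hb] using hz
    exact ⟨z, 0, hb, by simp [suspBase], by simp [suspHeight, this]⟩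
  set p : ℝ := 1 - inner ℝ b z with hp
  have hN : ‖z - b‖ ^ 2 = 2 * p - h ^ 2 := by
    rw [norm_sub_sq_real, hb, real_inner_comm, hp]; linarith
  have hNpos : 0 < ‖z - b‖ := norm_pos_iff.2 (sub_ne_zero.2 hzb)
  have hNsq : 0 < ‖z - b‖ ^ 2 := by positivity
  have hppos : 0 < p := by nlinarith [sq_nonneg h]
  set N := ‖z - b‖ with hNdef
  have hcirc : (h ^ 2 / p - 1) ^ 2 + (h * N / p) ^ 2 = 1 := by
    field_simp
    linear_combination h ^ 2 * hN
  obtain ⟨s, hc, hs⟩ := exists_unitInterval_cos_sin hcirc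
  have hib : (inner ℝ b (z - b) : ℝ) = -p := by
    rw [inner_sub_right, real_inner_self_eq_norm_sq, hb, hp]; ring
  set l : ℝ := 2 * p / N ^ 2 with hl
  have hlpos : 0 < l := by positivity
  refine ⟨b + l • (z - b), s, ?_, ?_, ?_⟩
  · have : ‖b + l • (z - b)‖ ^ 2 = 1 := by
      rw [norm_add_sq_real, inner_smul_right, norm_smul, mul_pow, hib, hb, Real.norm_eq_abs,
        sq_abs, ← hNdef, hl]
      field_simp
      ring
    exact (pow_eq_one_iff_of_nonneg (norm_nonneg _) two_ne_zero).1 this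
  · rw [← sub_left_inj (a := b), suspBase_sub, hc, add_sub_cancel_left, smul_smul]
    rw [show (1 - (h ^ 2 / p - 1)) / 2 * l = 1 by
      rw [hl]
      field_simp
      linarith, one_smul]
  · unfold suspHeight
    rw [hs, sub_add_cancel_left, norm_neg, norm_smul, Real.norm_of_nonneg hlpos.le, ← hNdef, hl]
    field_simp

end SphereSuspension

section SphereCoordinates

/-- Append a coordinate to a Euclidean vector. -/
noncomputable def euclideanSnoc {k : ℕ} (z : EuclideanSpace ℝ (Fin k)) (h : ℝ) :
    EuclideanSpace ℝ (Fin (k + 1)) :=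
  WithLp.toLp 2 (Fin.snoc (α := fun _ => ℝ) z.ofLp h)

lemma norm_euclideanSnoc_sq {k : ℕ} (z : EuclideanSpace ℝ (Fin k)) (h : ℝ) :
    ‖euclideanSnoc z h‖ ^ 2 = ‖z‖ ^ 2 + h ^ 2 := by
  simp [EuclideanSpace.norm_sq_eq, Fin.sum_univ_castSucc, euclideanSnoc]

lemma euclideanSnoc_injective {k : ℕ} {z z' : EuclideanSpace ℝ (Fin k)} {h h' : ℝ}
    (e : euclideanSnoc z h = euclideanSnoc z' h') : z = z' ∧ h = h' := by
  have e' := WithLp.toLp_injective 2 e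
  have := Fin.snoc_inj.1 e'
  exact ⟨WithLp.ofLp_injective 2 this.1, this.2⟩

lemma exists_euclideanSnoc {k : ℕ} (y : EuclideanSpace ℝ (Fin (k + 1))) :
    ∃ z h, euclideanSnoc z h = y :=
  ⟨WithLp.toLp 2 (Fin.init (α := fun _ => ℝ) y.ofLp), y (Fin.last k), by
    unfold euclideanSnoc
    ext i
    refine Fin.lastCases ?_ (fun j => ?_) i <;> simp [Fin.init]⟩

lemma euclideanSnoc_single {k : ℕ} :
    euclideanSnoc (EuclideanSpace.single (0 : Fin (k + 1)) (1 : ℝ)) 0 =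
      EuclideanSpace.single 0 1 := by
  unfold euclideanSnoc
  ext i
  refine Fin.lastCases ?_ (fun j => ?_) i
  · simp [(Fin.last_pos (n := k)).ne']
  · simp only [Fin.snoc_castSucc, PiLp.single_apply]
    exact if_congr Fin.castSucc_eq_zero_iff.symm rfl rfl

lemma continuous_euclideanSnoc {k : ℕ} :
    Continuous fun p : EuclideanSpace ℝ (Fin k) × ℝ => euclideanSnoc p.1 p.2 := by
  refine (PiLp.continuous_toLp 2 _).comp (continuous_pi fun i => ?_)
  refine Fin.lastCases ?_ (fun j => ?_) i
  · simpa using continuous_snd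
  · simpa using (by fun_prop : Continuous fun p : EuclideanSpace ℝ (Fin k) × ℝ => p.1 j)

instance (k : ℕ) : CompactSpace (Sph k) :=
  inferInstanceAs (CompactSpace (Metric.sphere (0 : EuclideanSpace ℝ (Fin (k + 1))) 1))

instance (k : ℕ) : T2Space (Sph k) :=
  inferInstanceAs (T2Space (Metric.sphere (0 : EuclideanSpace ℝ (Fin (k + 1))) 1))

lemma continuous_sph_val (k : ℕ) :
    Continuous fun x : Sph k => (x.1 : EuclideanSpace ℝ (Fin (k + 1))) :=
  continuous_subtype_val

lemma Sph.norm_eq {k : ℕ} (x : Sph k) : ‖(x.1 : EuclideanSpace ℝ (Fin (k + 1)))‖ = 1 :=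
  mem_sphere_zero_iff_norm.1 x.2

/-- The standard map `S^k × [0,1] → S^(k+1)` exhibiting the suspension of the sphere. -/
noncomputable def sphereSusp (k : ℕ) :
    C((Ptd.sphere k).carrier × 𝕀, (Ptd.sphere (k + 1)).carrier) where
  toFun p := ⟨euclideanSnoc (suspBase (Ptd.sphere k).pt.1 p.1.1 p.2)
    (suspHeight (Ptd.sphere k).pt.1 p.1.1 p.2), by
      rw [mem_sphere_zero_iff_norm, ← pow_eq_one_iff_of_nonneg (norm_nonneg _) two_ne_zero,
        norm_euclideanSnoc_sq]
      exact norm_suspBase_sq_add (Sph.norm_eq _) (Sph.norm_eq _) _⟩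
  continuous_toFun := by
    have h := continuous_sph_val k
    refine Continuous.subtype_mk (continuous_euclideanSnoc.comp (Continuous.prodMk ?_ ?_)) _
    · have h1 : Continuous fun p : (Ptd.sphere k).carrier × 𝕀 =>
        (p.1.1 : EuclideanSpace ℝ (Fin (k + 1))) := h.comp continuous_fst
      fun_prop
    · have h1 : Continuous fun p : (Ptd.sphere k).carrier × 𝕀 =>
        (p.1.1 : EuclideanSpace ℝ (Fin (k + 1))) := h.comp continuous_fst
      fun_prop

lemma isQuotientMap_sphereSusp (k : ℕ) : Topology.IsQuotientMap (sphereSusp k) := by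
  have : CompactSpace (Ptd.sphere k).carrier := inferInstanceAs (CompactSpace (Sph k))
  have : T2Space (Ptd.sphere (k + 1)).carrier := inferInstanceAs (T2Space (Sph (k + 1)))
  refine Topology.IsQuotientMap.of_surjective_continuous ?_ (sphereSusp k).continuous
  rintro ⟨y, hy⟩
  obtain ⟨z, h, rfl⟩ := exists_euclideanSnoc y
  have hzh : ‖z‖ ^ 2 + h ^ 2 = 1 := by
    rw [← norm_euclideanSnoc_sq, mem_sphere_zero_iff_norm.1 hy, one_pow]
  obtain ⟨x, s, hx, h1, h2⟩ := susp_surj (Sph.norm_eq (Ptd.sphere k).pt) hzh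
  refine ⟨(⟨x, mem_sphere_zero_iff_norm.2 hx⟩, s), Subtype.ext ?_⟩
  change euclideanSnoc (suspBase _ x s) (suspHeight _ x s) = _
  rw [h1, h2]

lemma sphereSusp_of_isBase {k : ℕ} {p : (Ptd.sphere k).carrier × 𝕀}
    (hp : (Ptd.sphere k).IsBase p) : sphereSusp k p = (Ptd.sphere (k + 1)).pt := by
  obtain ⟨x, s⟩ := p
  refine Subtype.ext ?_
  refine Eq.trans ?_ euclideanSnoc_single
  change euclideanSnoc _ _ = _
  rcases hp with h | h | h
  · obtain rfl : s = 0 := h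
    simp [suspBase, suspHeight, Ptd.sphere]
  · obtain rfl : s = 1 := h
    simp [suspBase, suspHeight, Ptd.sphere]
  · obtain rfl : x = _ := h
    simp [suspBase, suspHeight, Ptd.sphere]

lemma sphereSusp_ker {k : ℕ} (p p' : (Ptd.sphere k).carrier × 𝕀)
    (h : sphereSusp k p = sphereSusp k p') :
    p = p' ∨ (Ptd.sphere k).IsBase p ∧ (Ptd.sphere k).IsBase p' := by
  obtain ⟨x, s⟩ := p
  obtain ⟨x', s'⟩ := p'
  obtain ⟨h1, h2⟩ := euclideanSnoc_injective (congrArg Subtype.val h)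
  rcases susp_ker (Sph.norm_eq _) (Sph.norm_eq x) (Sph.norm_eq x') h1 h2 with ⟨h3, rfl⟩ | ⟨h3, h4⟩
  · left
    obtain rfl : x = x' := Subtype.ext h3
    rfl
  · exact .inr ⟨h3.imp_right (.imp_right Subtype.ext), h4.imp_right (.imp_right Subtype.ext)⟩

/-- The suspension wedge of wedges of spheres is a wedge of spheres. -/
lemma suspWedge_wedgeOfSpheres (ds es : List ℕ) :
    ((wedgeOfSpheres ds).suspWedge (wedgeOfSpheres es)).Equiv
      (wedgeOfSpheres (ds.map (· + 1) ++ es)) := by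
  induction ds with
  | nil => exact Ptd.suspWedge.point_equiv
  | cons d ds ih =>
    refine (Ptd.suspWedge.wedge_equiv (isQuotientMap_sphereSusp d)
      (fun _ => sphereSusp_of_isBase) sphereSusp_ker).trans ?_
    exact Ptd.wedge.equiv_congr_right ih

end SphereCoordinates

/-! ## Geometric realizations -/

section Realization

variable {V : Type} {K K' K'' : Set (Finset V)}

lemma geom.finsum_eq_of_support {f : V → ℝ} {s : Finset V} (hs : ∀ v, f v ≠ 0 → v ∈ s) :
    ∑ᶠ v, f v = ∑ v ∈ s, f v :=
  finsum_eq_sum_of_support_subset f hs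

lemma geom.continuous_val : Continuous fun f : geom K => f.1 := continuous_subtype_val

lemma geom.continuous_eval (v : V) : Continuous fun f : geom K => f.1 v :=
  (continuous_apply v).comp geom.continuous_val

instance : T2Space (geom K) := inferInstanceAs (T2Space {_f : V → ℝ // _})

lemma geom.le_one (f : geom K) (v : V) : f.1 v ≤ 1 := by
  obtain ⟨s, -, hs⟩ := f.2.1
  by_cases h : f.1 v = 0
  · rw [h]; exact zero_le_one
  · have h1 := f.2.2.2
    rw [geom.finsum_eq_of_support hs] at h1
    exact (Finset.single_le_sum (fun i _ => f.2.2.1 i) (hs v h)).trans h1.le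

lemma geom.compactSpace (hK : K.Finite) : CompactSpace (geom K) := by
  have key : IsCompact {f : V → ℝ |
      (∃ s ∈ K, ∀ v, f v ≠ 0 → v ∈ s) ∧ (∀ v, 0 ≤ f v) ∧ ∑ᶠ v, f v = 1} := by
    have : {f : V → ℝ | (∃ s ∈ K, ∀ v, f v ≠ 0 → v ∈ s) ∧ (∀ v, 0 ≤ f v) ∧ ∑ᶠ v, f v = 1} =
        ⋃ s ∈ K, {f : V → ℝ | (∀ v, v ∉ s → f v = 0) ∧ (∀ v, 0 ≤ f v) ∧ ∑ v ∈ s, f v = 1} := by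
      ext f
      simp only [Set.mem_ofPred_eq, Set.mem_iUnion, exists_prop]
      constructor
      · rintro ⟨⟨s, hsK, hs⟩, h0, h1⟩
        exact ⟨s, hsK, fun v hv => by_contra fun h => hv (hs v h), h0,
          (geom.finsum_eq_of_support hs).symm.trans h1⟩
      · rintro ⟨s, hsK, hs, h0, h1⟩
        have hs' : ∀ v, f v ≠ 0 → v ∈ s := fun v hv => by_contra fun h => hv (hs v h)
        exact ⟨⟨s, hsK, hs'⟩, h0, (geom.finsum_eq_of_support hs').trans h1⟩
    rw [this]
    refine hK.isCompact_biUnion fun s _ => ?_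
    refine IsCompact.of_isClosed_subset
      (isCompact_univ_pi fun _ : V => isCompact_Icc (a := (0 : ℝ)) (b := 1)) ?_ ?_
    · have e : {f : V → ℝ | (∀ v, v ∉ s → f v = 0) ∧ (∀ v, 0 ≤ f v) ∧ ∑ v ∈ s, f v = 1} =
          (⋂ v, ⋂ _ : v ∉ s, {f | f v = 0}) ∩ ((⋂ v, {f | 0 ≤ f v}) ∩ {f | ∑ v ∈ s, f v = 1}) := by
        ext f
        simp
      rw [e]
      refine IsClosed.inter ?_ (IsClosed.inter ?_ ?_)
      · exact isClosed_iInter fun v => isClosed_iInter fun _ =>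
          isClosed_eq (continuous_apply v) continuous_const
      · exact isClosed_iInter fun v => isClosed_le continuous_const (continuous_apply v)
      · exact isClosed_eq (continuous_finsetSum _ fun v _ => continuous_apply v) continuous_const
    · rintro f ⟨h0, h1, h2⟩ v -
      refine ⟨h1 v, ?_⟩
      by_cases hv : v ∈ s
      · exact h2 ▸ Finset.single_le_sum (fun i _ => h1 i) hv
      · rw [h0 v hv]; exact zero_le_one
  exact isCompact_iff_compactSpace.1 key

/-- A convex combination of two points supported on a common simplex. -/
lemma geom.mix_mem (f : geom K) (g : geom K') {s : Finset V} (hs : s ∈ K'')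
    (hf : ∀ v, f.1 v ≠ 0 → v ∈ s) (hg : ∀ v, g.1 v ≠ 0 → v ∈ s) {t : ℝ} (h0 : 0 ≤ t)
    (h1 : t ≤ 1) :
    (∃ s ∈ K'', ∀ v, ((1 - t) • f.1 + t • g.1) v ≠ 0 → v ∈ s) ∧
      (∀ v, 0 ≤ ((1 - t) • f.1 + t • g.1) v) ∧ ∑ᶠ v, ((1 - t) • f.1 + t • g.1) v = 1 := by
  have hsupp : ∀ v, ((1 - t) • f.1 + t • g.1) v ≠ 0 → v ∈ s := by
    intro v hv
    by_contra hvs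
    refine hv ?_
    simp [not_not.1 (mt (hf v) hvs), not_not.1 (mt (hg v) hvs)]
  refine ⟨⟨s, hs, hsupp⟩, fun v => ?_, ?_⟩
  · exact add_nonneg (mul_nonneg (by linarith) (f.2.2.1 v)) (mul_nonneg h0 (g.2.2.1 v))
  · rw [geom.finsum_eq_of_support hsupp]
    simp only [Pi.add_apply, Pi.smul_apply, smul_eq_mul, Finset.sum_add_distrib,
      ← Finset.mul_sum]
    rw [← geom.finsum_eq_of_support hf, ← geom.finsum_eq_of_support hg, f.2.2.2, g.2.2.2]
    ring

/-- The inclusion of realizations induced by an inclusion of complexes. -/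
def geom.incl (h : K ⊆ K') : C(geom K, geom K') where
  toFun f := ⟨f.1, let ⟨s, hs, hf⟩ := f.2.1; ⟨s, h hs, hf⟩, f.2.2⟩
  continuous_toFun := geom.continuous_val.subtype_mk _

variable [DecidableEq V]

lemma geomPt_apply_self {v : V} (h : {v} ∈ K) : (geomPt v h).1 v = 1 := if_pos rfl

lemma geomPt_apply_ne {v w : V} (h : {v} ∈ K) (hw : w ≠ v) : (geomPt v h).1 w = 0 := if_neg hw

lemma eq_of_geomPt_ne_zero {v w : V} {h : {v} ∈ K} (hw : (geomPt v h).1 w ≠ 0) : w = v := by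
  by_contra h'
  exact hw (geomPt_apply_ne h h')

lemma geom.eq_geomPt {f : geom K} {v : V} (h : f.1 v = 1) (hv : {v} ∈ K) : f = geomPt v hv := by
  refine Subtype.ext (funext fun w => ?_)
  by_cases hw : w = v
  · subst hw; rw [h, geomPt_apply_self]
  · rw [geomPt_apply_ne hv hw]
    obtain ⟨s, -, hs⟩ := f.2.1
    by_contra hne
    have h1 := f.2.2.2
    rw [geom.finsum_eq_of_support hs] at h1
    have hvs : v ∈ s := hs v (by rw [h]; exact one_ne_zero)
    have h2 := Finset.add_sum_erase s f.1 hvs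
    have h3 : 0 < ∑ x ∈ s.erase v, f.1 x :=
      Finset.sum_pos' (fun i _ => f.2.2.1 i)
        ⟨w, Finset.mem_erase.2 ⟨hw, hs w hne⟩, lt_of_le_of_ne (f.2.2.1 w) (Ne.symm hne)⟩
    linarith

/-- The realization of a down-closed complex has collared vertices. -/
noncomputable def geom.collar (v : V) (hv : {v} ∈ K) :
    Ptd.Collar { carrier := geom K, pt := geomPt v hv } where
  r p := ⟨(1 - ((1 - (p.2 : ℝ)) + p.2 * max 0 (2 * (1 - p.1.1 v) - 1))) • (geomPt v hv).1 +
      ((1 - (p.2 : ℝ)) + p.2 * max 0 (2 * (1 - p.1.1 v) - 1)) • p.1.1, by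
    have h0 := p.2.2.1
    have h1 := p.2.2.2
    obtain ⟨s, hs, hf⟩ := p.1.2.1
    by_cases hv0 : p.1.1 v = 0
    · rw [show (1 - (p.2 : ℝ)) + p.2 * max 0 (2 * (1 - p.1.1 v) - 1) = 1 by
        rw [hv0]; norm_num]
      simpa using p.1.2
    · have l1 : max 0 (2 * (1 - p.1.1 v) - 1) ≤ 1 :=
        max_le zero_le_one (by linarith [p.1.2.2.1 v])
      have l0 : 0 ≤ max 0 (2 * (1 - p.1.1 v) - 1) := le_max_left _ _
      refine geom.mix_mem _ _ hs (fun w hw => ?_) hf (by nlinarith) (by nlinarith)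
      rw [eq_of_geomPt_ne_zero hw]
      exact hf v hv0⟩
  u f := min 1 (2 * (1 - f.1 v))
  continuous_r := by
    have h1 : Continuous fun p : geom K × 𝕀 => p.1.1 v :=
      (geom.continuous_eval v).comp continuous_fst
    have h2 : Continuous fun p : geom K × 𝕀 => p.1.1 := geom.continuous_val.comp continuous_fst
    refine Continuous.subtype_mk ?_ _
    dsimp only
    fun_prop
  continuous_u := by
    have h1 : Continuous fun f : geom K => f.1 v := geom.continuous_eval v
    exact continuous_const.min (continuous_const.mul (continuous_const.sub h1))
  r_zero f := Subtype.ext (by simp)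
  r_pt t := Subtype.ext (by
    dsimp only
    rw [← add_smul, sub_add_cancel, one_smul])
  u_nonneg f := le_min zero_le_one (by linarith [geom.le_one f v])
  u_le f := min_le_left _ _
  u_pt := by simp [geomPt_apply_self]
  r_one f h := Subtype.ext (by
    have : 2 * (1 - f.1 v) < 1 := by simpa using h
    dsimp only
    rw [max_eq_left (by linarith)]
    simp)

/-- Two vertices spanning an edge are joined by a path. -/
lemma geom.joined {v w : V} (hv : {v} ∈ K) (hw : {w} ∈ K) (h : {v, w} ∈ K) :
    Joined (geomPt v hv) (geomPt w hw) := by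
  refine ⟨⟨⟨fun t => ⟨(1 - (t : ℝ)) • (geomPt v hv).1 + (t : ℝ) • (geomPt w hw).1,
    geom.mix_mem _ _ h (fun x hx => ?_) (fun x hx => ?_) t.2.1 t.2.2⟩, ?_⟩, ?_, ?_⟩⟩
  · simp [eq_of_geomPt_ne_zero hx]
  · simp [eq_of_geomPt_ne_zero hx]
  · refine Continuous.subtype_mk ?_ _
    fun_prop
  · exact Subtype.ext (by simp)
  · exact Subtype.ext (by simp)

/-- A cone with vertex apex is contractible onto its apex. -/
lemma geom.equiv_point_of_cone {v : V} (hv : {v} ∈ K) (h : ∀ s ∈ K, insert v s ∈ K) :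
    (Ptd.mk (geom K) (geomPt v hv)).Equiv Ptd.point := by
  refine ⟨ContinuousMap.const _ PUnit.unit, ContinuousMap.const _ (geomPt v hv), rfl, rfl, ?_,
    .refl _⟩
  refine homotopicRel_of_map (fun p => ⟨(1 - (p.2 : ℝ)) • (geomPt v hv).1 + (p.2 : ℝ) • p.1.1,
    ?_⟩) ?_ ?_ ?_ ?_
  · obtain ⟨s, hs, hf⟩ := p.1.2.1
    refine geom.mix_mem _ _ (h s hs) (fun x hx => ?_)
      (fun x hx => Finset.mem_insert_of_mem (hf x hx)) p.2.2.1 p.2.2.2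
    simp [eq_of_geomPt_ne_zero hx]
  · have h2 : Continuous fun p : geom K × 𝕀 => p.1.1 := geom.continuous_val.comp continuous_fst
    refine Continuous.subtype_mk ?_ _
    fun_prop
  · intro f
    exact Subtype.ext (by simp)
  · intro f
    exact Subtype.ext (by simp)
  · rintro _ rfl t
    exact Subtype.ext (by
      dsimp only
      rw [← add_smul, sub_add_cancel, one_smul]
      rfl)

end Realization

/-! ## Independence complexes of vertex subsets -/

section Independence

variable {V : Type} {G : SimpleGraph V} {S T R : Set V} {v w d : V}

/-- The complex of independent sets of `G` contained in `S`. -/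
def indOn (G : SimpleGraph V) (S : Set V) : Set (Finset V) :=
  {s | (↑s : Set V) ⊆ S ∧ ∀ u ∈ s, ∀ v ∈ s, ¬ G.Adj u v}

lemma indOn_mono (h : S ⊆ T) : indOn G S ⊆ indOn G T := fun _ hs => ⟨hs.1.trans h, hs.2⟩

lemma indOn_finite (hS : S.Finite) : (indOn G S).Finite := by
  refine hS.toFinset.powerset.finite_toSet.subset fun s hs => ?_
  rw [Finset.mem_coe, Finset.mem_powerset]
  exact fun x hx => hS.mem_toFinset.2 (hs.1 hx)

lemma singleton_mem_indOn (G : SimpleGraph V) (hv : v ∈ S) : {v} ∈ indOn G S :=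
  ⟨by simpa using hv, by simp⟩

/-- The vertices of `S` other than `v` that are not adjacent to `v`. -/
def link (G : SimpleGraph V) (S : Set V) (v : V) : Set V := {x | x ∈ S ∧ x ≠ v ∧ ¬ G.Adj v x}

lemma link_subset : link G S v ⊆ S \ {v} := fun _ hx => ⟨hx.1, hx.2.1⟩

lemma geom.eq_zero_of_notMem (f : geom (indOn G S)) (hv : v ∉ S) : f.1 v = 0 := by
  obtain ⟨s, hs, hf⟩ := f.2.1
  by_contra h
  exact hv (hs.1 (hf v h))

variable [DecidableEq V]

lemma pair_mem_indOn (hv : v ∈ S) (hw : w ∈ S) (h : ¬ G.Adj v w) : {v, w} ∈ indOn G S := by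
  refine ⟨by simp [Set.insert_subset_iff, hv, hw], ?_⟩
  simp [h, mt SimpleGraph.Adj.symm h]

/-- The realization of the independence complex on `S`, pointed at a vertex. -/
noncomputable def indPtd (G : SimpleGraph V) (hv : v ∈ S) : Ptd where
  carrier := geom (indOn G S)
  pt := geomPt v (singleton_mem_indOn G hv)

lemma insert_mem_indOn_of_link (hv : v ∈ S) {s : Finset V} (hs : s ∈ indOn G (link G S v)) :
    insert v s ∈ indOn G S := by
  refine ⟨?_, ?_⟩
  · rw [Finset.coe_insert]
    exact Set.insert_subset hv (hs.1.trans fun x hx => hx.1)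
  · intro a ha b hb
    rcases Finset.mem_insert.1 ha with rfl | ha'
    · rcases Finset.mem_insert.1 hb with rfl | hb'
      · exact G.irrefl
      · exact (hs.1 hb').2.2
    · rcases Finset.mem_insert.1 hb with rfl | hb'
      · exact fun h => (hs.1 ha').2.2 h.symm
      · exact hs.2 a ha' b hb'

lemma mem_indOn_erase {s : Finset V} (hs : s ∈ indOn G S) : s.erase v ∈ indOn G (S \ {v}) := by
  refine ⟨fun x hx => ?_, fun a ha b hb => hs.2 a (Finset.mem_of_mem_erase ha) b
    (Finset.mem_of_mem_erase hb)⟩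
  have hx := Finset.mem_erase.1 (Finset.mem_coe.1 hx)
  exact ⟨hs.1 hx.2, hx.1⟩

lemma mem_indOn_link_erase {s : Finset V} (hs : s ∈ indOn G S) (hv : v ∈ s) :
    s.erase v ∈ indOn G (link G S v) := by
  refine ⟨fun x hx => ?_, (mem_indOn_erase hs).2⟩
  have hx := Finset.mem_erase.1 (Finset.mem_coe.1 hx)
  exact ⟨hs.1 hx.2, hx.1, hs.2 v hv x hx.2⟩

/-- A point of the realization vanishing at `v` lies in the realization without `v`. -/
def geom.restrict (f : geom (indOn G S)) (h : f.1 v = 0) : geom (indOn G (S \ {v})) :=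
  ⟨f.1, by
    obtain ⟨s, hs, hf⟩ := f.2.1
    exact ⟨_, mem_indOn_erase hs, fun x hx =>
      Finset.mem_erase.2 ⟨fun e => hx (e ▸ h), hf x hx⟩⟩, f.2.2⟩

/-- The inclusion of the link of a vertex into its deletion. -/
abbrev linkIncl (G : SimpleGraph V) (S : Set V) (v : V) :
    C(geom (indOn G (link G S v)), geom (indOn G (S \ {v}))) :=
  geom.incl (indOn_mono link_subset)

/-- The map from the mapping cone of the inclusion of the link of `v` that sends the apex
to `v`. -/
noncomputable def coneMap (hv : v ∈ S) : MappingCone (linkIncl G S v) → geom (indOn G S) :=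
  MappingCone.desc (fun f s => ⟨(1 - (s : ℝ)) • (geomPt v (singleton_mem_indOn G hv)).1 +
      (s : ℝ) • f.1, by
      obtain ⟨t, ht, hf⟩ := f.2.1
      refine geom.mix_mem _ _ (insert_mem_indOn_of_link hv ht) (fun x hx => ?_)
        (fun x hx => Finset.mem_insert_of_mem (hf x hx)) s.2.1 s.2.2
      simp [eq_of_geomPt_ne_zero hx]⟩)
    (geom.incl (indOn_mono Set.sdiff_subset)) (fun f f' => Subtype.ext (by simp))
    (fun f => Subtype.ext (by simp; rfl))

lemma continuous_coneMap (hv : v ∈ S) : Continuous (coneMap (G := G) hv) := by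
  refine MappingCone.continuous_of (Continuous.subtype_mk ?_ _) (ContinuousMap.continuous _)
  have h2 : Continuous fun p : geom (indOn G (link G S v)) × 𝕀 => p.1.1 :=
    geom.continuous_val.comp continuous_fst
  fun_prop

lemma coneMap_cyl_self (hv : v ∈ S) (f : geom (indOn G (link G S v))) (s : 𝕀) :
    (coneMap hv (MappingCone.cyl _ f s)).1 v = 1 - s := by
  change (1 - (s : ℝ)) * _ + s * f.1 v = _
  rw [geomPt_apply_self, geom.eq_zero_of_notMem f (fun h => h.2.1 rfl)]
  ring

lemma coneMap_cyl_ne (hv : v ∈ S) (f : geom (indOn G (link G S v))) (s : 𝕀) (hw : w ≠ v) :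
    (coneMap hv (MappingCone.cyl _ f s)).1 w = s * f.1 w := by
  change (1 - (s : ℝ)) * _ + s * f.1 w = _
  rw [geomPt_apply_ne _ hw]
  ring

lemma coneMap_injective (hv : v ∈ S) : Function.Injective (coneMap (G := G) hv) := by
  have inr_cyl : ∀ (g : geom (indOn G (S \ {v}))) (f : geom (indOn G (link G S v))) (s : 𝕀),
      coneMap hv (MappingCone.inr _ g) = coneMap hv (MappingCone.cyl _ f s) →
      MappingCone.inr _ g = MappingCone.cyl (linkIncl G S v) f s := by
    intro g f s h
    have h1 : g.1 v = 1 - s := by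
      rw [← coneMap_cyl_self hv f s, ← h]
      rfl
    rw [geom.eq_zero_of_notMem g (fun h => h.2 rfl)] at h1
    obtain rfl : s = 1 := Subtype.ext (by rw [Set.Icc.coe_one]; linarith)
    rw [MappingCone.cyl_one] at h ⊢
    have h' := congrArg Subtype.val h
    exact congrArg (MappingCone.inr _) (Subtype.ext h')
  refine MappingCone.ind (fun f s => ?_) fun g => ?_
  · refine MappingCone.ind (fun f' s' h => ?_) fun g h => (inr_cyl g f s h.symm).symm
    have h1 := coneMap_cyl_self hv f s
    rw [h, coneMap_cyl_self] at h1
    obtain rfl : s = s' := Subtype.ext (by linarith)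
    by_cases hs : s = 0
    · rw [hs]
      exact MappingCone.cyl_zero _ _
    · congr 1
      refine Subtype.ext (funext fun w => ?_)
      by_cases hw : w = v
      · rw [geom.eq_zero_of_notMem f (fun h => h.2.1 hw),
          geom.eq_zero_of_notMem f' (fun h => h.2.1 hw)]
      · have h2 := coneMap_cyl_ne hv f s hw
        rw [h, coneMap_cyl_ne hv f' s hw] at h2
        exact (mul_left_cancel₀ (fun h => hs (Subtype.ext h)) h2).symm
  · refine MappingCone.ind (fun f s h => inr_cyl g f s h) fun g' h => ?_
    have h' := congrArg Subtype.val h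
    exact congrArg (MappingCone.inr _) (Subtype.ext h')

lemma coneMap_surjective (hv : v ∈ S) (hne : (link G S v).Nonempty) :
    Function.Surjective (coneMap (G := G) hv) := by
  intro f
  by_cases h0 : f.1 v = 0
  · exact ⟨MappingCone.inr _ (f.restrict h0), rfl⟩
  by_cases h1 : f.1 v = 1
  · obtain ⟨w, hw⟩ := hne
    refine ⟨MappingCone.cyl _ (geomPt w (singleton_mem_indOn G hw)) 0, ?_⟩
    rw [geom.eq_geomPt h1 (singleton_mem_indOn G hv)]
    refine geom.eq_geomPt ?_ _
    rw [coneMap_cyl_self]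
    simp
  have hle := geom.le_one f v
  have hpos : 0 < 1 - f.1 v := sub_pos.2 (lt_of_le_of_ne hle h1)
  obtain ⟨s, hs, hf⟩ := f.2.1
  have hvs : v ∈ s := hf v h0
  let g : V → ℝ := fun w => if w = v then 0 else f.1 w / (1 - f.1 v)
  have hg : ∀ w, g w ≠ 0 → w ∈ s.erase v := by
    intro w hw
    by_cases hwv : w = v
    · exact absurd (if_pos hwv) hw
    · refine Finset.mem_erase.2 ⟨hwv, hf w fun h => hw ?_⟩
      simp [g, h]
  have hsum : ∑ᶠ w, g w = 1 := by
    rw [geom.finsum_eq_of_support hg]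
    have h2 : ∑ w ∈ s.erase v, g w = ∑ w ∈ s.erase v, f.1 w / (1 - f.1 v) :=
      Finset.sum_congr rfl fun w hw => if_neg (Finset.ne_of_mem_erase hw)
    have h3 := f.2.2.2
    rw [geom.finsum_eq_of_support hf, ← Finset.add_sum_erase s f.1 hvs] at h3
    rw [h2, ← Finset.sum_div, div_eq_one_iff_eq hpos.ne']
    linarith
  have hnn : ∀ w, 0 ≤ g w := by
    intro w
    by_cases hwv : w = v
    · exact (if_pos hwv).ge
    · rw [show g w = _ from if_neg hwv]
      exact div_nonneg (f.2.2.1 w) hpos.le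
  let g' : geom (indOn G (link G S v)) := ⟨g, ⟨_, mem_indOn_link_erase hs hvs, hg⟩, hnn, hsum⟩
  refine ⟨MappingCone.cyl _ g' ⟨1 - f.1 v, hpos.le, by linarith [f.2.2.1 v]⟩, Subtype.ext (funext fun w => ?_)⟩
  by_cases hw : w = v
  · subst hw
    rw [coneMap_cyl_self]
    ring
  · rw [coneMap_cyl_ne hv _ _ hw]
    change (1 - f.1 v) * g w = _
    rw [show g w = _ from if_neg hw]
    field_simp

lemma equiv_mappingCone (hS : S.Finite) (hv : v ∈ S) (hne : (link G S v).Nonempty)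
    (hd : d ∈ S \ {v}) :
    (MappingCone.ptd (linkIncl G S v) (geomPt d (singleton_mem_indOn G hd))).Equiv
      (indPtd G hd.1) := by
  have := geom.compactSpace (indOn_finite (G := G) (hS.subset (fun x hx => hx.1 :
    link G S v ⊆ S)))
  have := geom.compactSpace (indOn_finite (G := G) (hS.subset (Set.sdiff_subset (t := {v}))))
  have : CompactSpace (MappingCone (linkIncl G S v)) := Quot.compactSpace
  let e := Equiv.ofBijective (coneMap (G := G) hv)
    ⟨coneMap_injective hv, coneMap_surjective hv hne⟩
  let φ := Continuous.homeoOfEquivCompactToT2 (f := e) (continuous_coneMap hv)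
  exact Ptd.Equiv.of_inverse (f := φ) (g := φ.symm) φ.continuous φ.symm.continuous
    rfl φ.symm_apply_apply φ.apply_symm_apply

/-- `S` has the pointed homotopy type of a wedge of spheres of dimensions `ds`, based at `d`. -/
def HasType (G : SimpleGraph V) (S : Set V) (d : V) (ds : List ℕ) : Prop :=
  ∃ hd : d ∈ S, (indPtd G hd).Equiv (wedgeOfSpheres ds)

/-- Attaching a vertex whose link has null-homotopic inclusion into its deletion. -/
lemma HasType.attach_of_homotopic {l : V} {ds es : List ℕ} (hS : S.Finite) (hv : v ∈ S)
    (hD : HasType G (S \ {v}) d es) (hL : HasType G (link G S v) l ds)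
    (h : (linkIncl G S v).Homotopic
      (ContinuousMap.const _ (geomPt d (singleton_mem_indOn G hD.1)))) :
    HasType G S d (ds.map (· + 1) ++ es) := by
  obtain ⟨hd, hD⟩ := hD
  obtain ⟨hl, hL⟩ := hL
  obtain ⟨H⟩ := h
  refine ⟨hd.1, ?_⟩
  refine (equiv_mappingCone hS hv ⟨l, hl⟩ hd).symm.trans ?_
  refine (MappingCone.equiv_of_homotopy H _).trans ?_
  refine (MappingCone.equiv_suspWedge (X := indPtd G hl) (geom.collar l _)
    (indPtd G hd)).trans ?_
  exact (Ptd.suspWedge.equiv_congr hL hD).trans (suspWedge_wedgeOfSpheres ds es)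

/-- Any two vertices of `S` are connected by a path of pairwise nonadjacent vertices. -/
def CoConnected (G : SimpleGraph V) (S : Set V) : Prop :=
  ∀ x ∈ S, ∀ y ∈ S, Relation.ReflTransGen (fun a b => a ∈ S ∧ b ∈ S ∧ ¬ G.Adj a b) x y

lemma CoConnected.joined (h : CoConnected G S) (hv : v ∈ S) (hw : w ∈ S) :
    Joined (geomPt v (singleton_mem_indOn G hv)) (geomPt w (singleton_mem_indOn G hw)) := by
  have key : ∀ w, Relation.ReflTransGen (fun a b => a ∈ S ∧ b ∈ S ∧ ¬ G.Adj a b) v w →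
      ∃ hw : w ∈ S,
        Joined (geomPt v (singleton_mem_indOn G hv)) (geomPt w (singleton_mem_indOn G hw)) := by
    intro w h
    induction h with
    | refl => exact ⟨hv, Joined.refl _⟩
    | tail _ h ih =>
      obtain ⟨hb, ih⟩ := ih
      exact ⟨h.2.1, ih.trans (geom.joined _ _ (pair_mem_indOn h.1 h.2.1 h.2.2))⟩
  exact (key w (h v hv w hw)).2

lemma geom.incl_homotopic_const {r : V} (hLR : S ⊆ R) (hRT : R ⊆ T) (hR : HasType G R r [])
    (hT : CoConnected G T) (hd : d ∈ T) :
    (geom.incl (indOn_mono (G := G) (hLR.trans hRT))).Homotopic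
      (ContinuousMap.const _ (geomPt d (singleton_mem_indOn G hd))) := by
  obtain ⟨hr, f, g, -, hg, h1, -⟩ := hR
  have hc : g.comp f = ContinuousMap.const _ (geomPt r (singleton_mem_indOn G hr)) :=
    ContinuousMap.ext fun _ => hg
  rw [hc] at h1
  have h2 := ((ContinuousMap.Homotopic.refl (geom.incl (indOn_mono (G := G) hRT))).comp
    (h1.homotopic.comp (ContinuousMap.Homotopic.refl
      (geom.incl (indOn_mono (G := G) hLR))))).symm
  refine ContinuousMap.Homotopic.trans h2 ?_
  obtain ⟨γ⟩ := hT.joined (hRT hr) hd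
  refine ContinuousMap.HomotopicRel.homotopic (S := ∅) (homotopicRel_of_map
    (fun p => γ p.2) (by fun_prop) (fun _ => ?_) (fun _ => ?_) (by simp))
  · exact γ.source
  · exact γ.target

/-- Attaching a vertex whose link lies in a contractible subcomplex of its deletion. -/
lemma HasType.attach {l r : V} {ds es : List ℕ} (hS : S.Finite) (hv : v ∈ S)
    (hD : HasType G (S \ {v}) d es) (hL : HasType G (link G S v) l ds)
    (hconn : CoConnected G (S \ {v})) (hLR : link G S v ⊆ R) (hRD : R ⊆ S \ {v})
    (hR : HasType G R r []) : HasType G S d (ds.map (· + 1) ++ es) :=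
  HasType.attach_of_homotopic hS hv hD hL (geom.incl_homotopic_const hLR hRD hR hconn hD.1)

/-- A vertex with no neighbours is a cone apex. -/
lemma HasType.of_isolated (hv : v ∈ S) (h : ∀ x ∈ S, ¬ G.Adj v x) : HasType G S v [] := by
  refine ⟨hv, geom.equiv_point_of_cone _ fun s hs => ⟨?_, ?_⟩⟩
  · rw [Finset.coe_insert]
    exact Set.insert_subset hv hs.1
  · intro a ha b hb
    rcases Finset.mem_insert.1 ha with rfl | ha'
    · rcases Finset.mem_insert.1 hb with rfl | hb'
      · exact G.irrefl
      · exact h b (hs.1 hb')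
    · rcases Finset.mem_insert.1 hb with rfl | hb'
      · exact fun h' => h a (hs.1 ha') h'.symm
      · exact hs.2 a ha' b hb'

/-- Adding a disjoint base point to a contractible space gives the `0`-sphere. -/
lemma punit_sum_equiv {X : Ptd} (h : X.Equiv Ptd.point) :
    (Ptd.mk (PUnit.{1} ⊕ X.carrier) (Sum.inl PUnit.unit)).Equiv (wedgeOfSpheres [0]) := by
  obtain ⟨f, g, -, hg, h1, -⟩ := h
  obtain ⟨H⟩ := h1
  let b : (Ptd.sphere 0).carrier := (Ptd.sphere 0).pt
  let n : (Ptd.sphere 0).carrier := ⟨-b.1, by simpa using b.2⟩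
  have hb0 : b.1 0 = 1 := by simp [b, Ptd.sphere]
  have hn0 : n.1 0 = -1 := by simp [n, hb0]
  have cases : ∀ x : (Ptd.sphere 0).carrier, x = b ∨ x = n := by
    intro x
    have hx := Sph.norm_eq x
    rw [EuclideanSpace.norm_eq, Real.sqrt_eq_one] at hx
    simp only [Nat.reduceAdd, Finset.univ_unique, Fin.default_eq_zero, Fin.isValue,
      Real.norm_eq_abs, sq_abs, Finset.sum_singleton] at hx
    rcases sq_eq_one_iff.1 hx with h | h
    · left
      refine Subtype.ext (PiLp.ext fun i => ?_)
      obtain rfl : i = 0 := Fin.eq_zero i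
      exact h.trans hb0.symm
    · right
      refine Subtype.ext (PiLp.ext fun i => ?_)
      obtain rfl : i = 0 := Fin.eq_zero i
      exact h.trans hn0.symm
  let F : PUnit.{1} ⊕ X.carrier → (wedgeOfSpheres [0]).carrier :=
    Sum.elim (fun _ => Ptd.wedge.inl (Ptd.sphere 0) Ptd.point b)
      (fun _ => Ptd.wedge.inl (Ptd.sphere 0) Ptd.point n)
  let k : (Ptd.sphere 0).carrier → PUnit.{1} ⊕ X.carrier := fun x =>
    if x.1 0 ≤ 0 then Sum.inr X.pt else Sum.inl PUnit.unit
  have kb : k b = Sum.inl PUnit.unit := if_neg (by rw [hb0]; norm_num)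
  have kn : k n = Sum.inr X.pt := if_pos (by rw [hn0]; norm_num)
  have hk : Continuous k := by
    have hx : Continuous fun x : (Ptd.sphere 0).carrier => x.1 0 :=
      (PiLp.continuous_apply 2 (fun _ : Fin 1 => ℝ) 0).comp (continuous_sph_val 0)
    refine Continuous.if_le continuous_const continuous_const hx continuous_const fun x h => ?_
    rcases cases x with rfl | rfl
    · rw [hb0] at h; norm_num at h
    · rw [hn0] at h; norm_num at h
  refine ⟨⟨F, continuous_const.sumElim continuous_const⟩,
    ⟨Ptd.wedge.desc k (fun _ => Sum.inl PUnit.unit) kb,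
      Ptd.wedge.continuous_of hk continuous_const⟩, rfl, kb, ?_, ?_⟩
  · refine homotopicRel_of_map (fun p => Sum.map id (fun x => H (p.2, x)) p.1) ?_ ?_ ?_ ?_
    · have : (fun p : (PUnit.{1} ⊕ X.carrier) × 𝕀 => Sum.map id (fun x => H (p.2, x)) p.1) =
          Sum.elim (fun p : PUnit.{1} × 𝕀 => Sum.inl p.1)
            (fun p : X.carrier × 𝕀 => Sum.inr (H (p.2, p.1))) ∘ Homeomorph.sumProdDistrib := by
        ext ⟨x | x, t⟩ <;> rfl
      rw [this]
      refine Continuous.comp (Continuous.sumElim ?_ ?_) (Homeomorph.continuous _) <;> fun_prop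
    · rintro (x | x)
      · exact kb.symm
      · refine Eq.trans ?_ kn.symm
        exact congrArg Sum.inr ((H.apply_zero x).trans hg)
    · rintro (x | x)
      · rfl
      · exact congrArg Sum.inr (H.apply_one x)
    · rintro _ rfl t
      exact kb.symm
  · convert ContinuousMap.HomotopicRel.refl _
    refine ContinuousMap.ext (Ptd.wedge.ind (fun x => ?_) fun y => ?_)
    · change Ptd.wedge.inl _ _ x = F (k x)
      rcases cases x with rfl | rfl
      · rw [kb]; rfl
      · rw [kn]; rfl
    · exact Ptd.wedge.inr_pt

/-- Adding a vertex adjacent to everything. -/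
lemma HasType.attach_of_link_empty (hS : S.Finite) (hv : v ∈ S) (hL : link G S v = ∅)
    (hD : HasType G (S \ {v}) d []) : HasType G S v [0] := by
  obtain ⟨hd, hD⟩ := hD
  refine ⟨hv, Ptd.Equiv.trans (Ptd.Equiv.symm ?_) (punit_sum_equiv hD)⟩
  have := geom.compactSpace (indOn_finite (G := G) (hS.subset (Set.sdiff_subset (t := {v}))))
  let Φ : PUnit.{1} ⊕ geom (indOn G (S \ {v})) → geom (indOn G S) :=
    Sum.elim (fun _ => geomPt v (singleton_mem_indOn G hv))
      (geom.incl (indOn_mono Set.sdiff_subset))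
  have hΦ : Continuous Φ := continuous_const.sumElim (ContinuousMap.continuous _)
  have hval : ∀ f, (Φ (Sum.inr f)).1 v = 0 := fun f =>
    geom.eq_zero_of_notMem f (fun h => h.2 rfl)
  have hval' : ∀ x, (Φ (Sum.inl x)).1 v = 1 := fun x =>
    geomPt_apply_self (singleton_mem_indOn G hv)
  have hbij : Function.Bijective Φ := by
    constructor
    · rintro (x | x) (y | y) h
      · rfl
      · have := hval' x
        rw [h, hval] at this
        norm_num at this
      · have := hval' y
        rw [← h, hval] at this
        norm_num at this
      · have h' := congrArg Subtype.val h
        exact congrArg Sum.inr (Subtype.ext h')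
    · intro f
      by_cases h0 : f.1 v = 0
      · exact ⟨Sum.inr (f.restrict h0), rfl⟩
      · refine ⟨Sum.inl PUnit.unit, ?_⟩
        obtain ⟨s, hs, hf⟩ := f.2.1
        have hsv : ∀ w, f.1 w ≠ 0 → w ∈ ({v} : Finset V) := by
          intro w hw
          by_contra hwv
          have : w ∈ link G S v := ⟨hs.1 (hf w hw), by simpa using hwv,
            hs.2 v (hf v h0) w (hf w hw)⟩
          rw [hL] at this
          exact this
        have h1 := f.2.2.2
        rw [geom.finsum_eq_of_support hsv, Finset.sum_singleton] at h1
        exact (geom.eq_geomPt h1 (singleton_mem_indOn G hv)).symm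
  let φ := Continuous.homeoOfEquivCompactToT2 (f := Equiv.ofBijective Φ hbij) hΦ
  exact Ptd.Equiv.of_inverse (X := Ptd.mk (PUnit.{1} ⊕ geom (indOn G (S \ {v})))
    (Sum.inl PUnit.unit)) (f := φ) (g := φ.symm) φ.continuous φ.symm.continuous
    rfl φ.symm_apply_apply φ.apply_symm_apply

end Independence

/-! ## Recursive rules for independence complexes -/

section Rules

variable {V : Type} {G : SimpleGraph V} {S R : Set V} {v w x y : V}

lemma CoConnected.of_isolated (hv : v ∈ S) (h : ∀ x ∈ S, ¬ G.Adj v x) : CoConnected G S :=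
  fun x hx y hy => .tail (.single ⟨hx, hv, fun e => h x hx e.symm⟩) ⟨hv, hy, h y hy⟩

lemma CoConnected.of_sdiff (hv : v ∈ S) (h : CoConnected G (S \ {v}))
    (hne : (link G S v).Nonempty) : CoConnected G S := by
  obtain ⟨w, hw⟩ := hne
  have hr : ∀ x ∈ S, Relation.ReflTransGen (fun a b => a ∈ S ∧ b ∈ S ∧ ¬ G.Adj a b) x w ∧
      Relation.ReflTransGen (fun a b => a ∈ S ∧ b ∈ S ∧ ¬ G.Adj a b) w x := by
    intro x hx
    by_cases hxv : x = v
    · subst hxv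
      exact ⟨.single ⟨hx, hw.1, hw.2.2⟩, .single ⟨hw.1, hx, fun e => hw.2.2 e.symm⟩⟩
    · have mono : ∀ a b, (a ∈ S \ {v} ∧ b ∈ S \ {v} ∧ ¬ G.Adj a b) →
          a ∈ S ∧ b ∈ S ∧ ¬ G.Adj a b := fun a b h => ⟨h.1.1, h.2.1.1, h.2.2⟩
      exact ⟨Relation.ReflTransGen.mono mono _ _ (h x ⟨hx, hxv⟩ w (link_subset hw)),
        Relation.ReflTransGen.mono mono _ _ (h w (link_subset hw) x ⟨hx, hxv⟩)⟩
  exact fun x hx y hy => (hr x hx).1.trans (hr y hy).2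

lemma CoConnected.of_leaf (hx : x ∈ S) (hy : y ∈ S) (hxy : G.Adj x y)
    (hleaf : ∀ z ∈ S, G.Adj x z → z = y) (hL : (link G S y).Nonempty) : CoConnected G S :=
  CoConnected.of_sdiff hy (CoConnected.of_isolated (⟨hx, hxy.ne⟩ : x ∈ S \ {y})
    fun z hz h => hz.2 (hleaf z hz.1 h)) hL

/-- The first `N` terms of `p` form an induced path that is disjoint from `R` and not
adjacent to it. -/
structure InducedPath (G : SimpleGraph V) (R : Set V) (p : ℕ → V) (N : ℕ) : Prop where
  inj : ∀ i < N, ∀ j < N, p i = p j → i = j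
  adj : ∀ i < N, ∀ j < N, (G.Adj (p i) (p j) ↔ j = i + 1 ∨ i = j + 1)
  notMem : ∀ i < N, p i ∉ R
  not_adj : ∀ i < N, ∀ z ∈ R, ¬ G.Adj (p i) z

variable {p : ℕ → V} {N α β : ℕ}

namespace InducedPath

lemma mem_iff (h : InducedPath G R p N) {i : ℕ} (hi : i < N) (hβ : β ≤ N) :
    p i ∈ R ∪ p '' Set.Ico α β ↔ α ≤ i ∧ i < β := by
  constructor
  · rintro (h' | ⟨j, hj, hij⟩)
    · exact (h.notMem i hi h').elim
    · rw [← h.inj j (hj.2.trans_le hβ) i hi hij]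
      exact hj
  · exact fun hi => Or.inr ⟨i, hi, rfl⟩

lemma leaf (h : InducedPath G R p N) (hβ : β ≤ N) (hαβ : α + 2 ≤ β) :
    p (β - 1) ∈ R ∪ p '' Set.Ico α β ∧ p (β - 2) ∈ R ∪ p '' Set.Ico α β ∧
      G.Adj (p (β - 1)) (p (β - 2)) ∧
      (∀ z ∈ R ∪ p '' Set.Ico α β, G.Adj (p (β - 1)) z → z = p (β - 2)) ∧
      link G (R ∪ p '' Set.Ico α β) (p (β - 2)) = R ∪ p '' Set.Ico α (β - 3) := by
  refine ⟨(h.mem_iff (by omega) hβ).2 (by omega), (h.mem_iff (by omega) hβ).2 (by omega),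
    (h.adj _ (by omega) _ (by omega)).2 (by omega), ?_, ?_⟩
  · rintro z (hz | ⟨j, hj, rfl⟩) hz'
    · exact (h.not_adj _ (by omega) z hz hz').elim
    · have := hj.2
      rw [h.adj _ (by omega) _ (by omega)] at hz'
      congr 1
      omega
  · ext z
    constructor
    · rintro ⟨hz | ⟨j, hj, rfl⟩, hne, hadj⟩
      · exact Or.inl hz
      · have := hj.2
        rw [h.adj _ (by omega) _ (by omega)] at hadj
        have : j ≠ β - 2 := fun e => hne (e ▸ rfl)
        exact Or.inr ⟨j, ⟨hj.1, by omega⟩, rfl⟩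
    · rintro (hz | ⟨j, hj, rfl⟩)
      · exact ⟨Or.inl hz, fun e => h.notMem _ (by omega) (e ▸ hz),
          h.not_adj _ (by omega) z hz⟩
      · have := hj.2
        refine ⟨Or.inr ⟨j, ⟨hj.1, by omega⟩, rfl⟩, fun e => ?_, ?_⟩
        · have := h.inj _ (by omega) _ (by omega) e
          omega
        · rw [h.adj _ (by omega) _ (by omega)]
          omega

lemma coConnected (h : InducedPath G R p N) (hβ : β ≤ N) (hαβ : α + 4 ≤ β) :
    CoConnected G (R ∪ p '' Set.Ico α β) := by
  obtain ⟨h1, h2, h3, h4, h5⟩ := h.leaf hβ (α := α) (by omega)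
  refine CoConnected.of_leaf h1 h2 h3 h4 ⟨p α, ?_⟩
  rw [h5]
  exact Or.inr ⟨α, ⟨le_rfl, by omega⟩, rfl⟩

lemma single_isolated (h : InducedPath G R p N) (hα : α < N) :
    ∀ z ∈ R ∪ p '' Set.Ico α (α + 1), ¬ G.Adj (p α) z := by
  rintro z (hz | ⟨j, hj, rfl⟩)
  · exact h.not_adj _ hα z hz
  · obtain rfl : j = α := by have := hj.1; have := hj.2; omega
    exact G.irrefl

end InducedPath

variable [DecidableEq V]

/-- The independence complex on `S` is a wedge of spheres. -/
def IsWedge (G : SimpleGraph V) (S : Set V) : Prop := ∃ d ds, HasType G S d ds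

/-- The independence complex on `S` is contractible. -/
def IsContr (G : SimpleGraph V) (S : Set V) : Prop := ∃ d, HasType G S d []

lemma IsContr.isWedge (h : IsContr G S) : IsWedge G S :=
  let ⟨d, h⟩ := h
  ⟨d, [], h⟩

lemma IsWedge.nonempty (h : IsWedge G S) : S.Nonempty :=
  let ⟨d, _, h, _⟩ := h
  ⟨d, h⟩

lemma IsContr.of_isolated (hv : v ∈ S) (h : ∀ x ∈ S, ¬ G.Adj v x) : IsContr G S :=
  ⟨v, HasType.of_isolated hv h⟩

/-- The complex obtained by adding a vertex with link contained in a contractible subcomplex. -/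
lemma IsWedge.attach (hS : S.Finite) (hv : v ∈ S) (hD : IsWedge G (S \ {v}))
    (hL : IsWedge G (link G S v)) (hconn : CoConnected G (S \ {v}))
    (hLR : link G S v ⊆ R) (hRD : R ⊆ S \ {v}) (hR : IsContr G R) : IsWedge G S := by
  obtain ⟨d, es, hD⟩ := hD
  obtain ⟨l, ds, hL⟩ := hL
  obtain ⟨r, hR⟩ := hR
  exact ⟨d, _, HasType.attach hS hv hD hL hconn hLR hRD hR⟩

/-- If the only neighbour of `x` is `y`, then the complex is the suspension of the link
of `y`. -/
lemma HasType.of_leaf {l : V} {ds : List ℕ} (hS : S.Finite) (hx : x ∈ S) (hy : y ∈ S)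
    (hxy : G.Adj x y) (hleaf : ∀ z ∈ S, G.Adj x z → z = y)
    (hL : HasType G (link G S y) l ds) : HasType G S x (ds.map (· + 1)) := by
  have hiso : ∀ z ∈ S \ {y}, ¬ G.Adj x z := fun z hz h => hz.2 (hleaf z hz.1 h)
  have hxD : x ∈ S \ {y} := ⟨hx, hxy.ne⟩
  have := HasType.attach hS hy (HasType.of_isolated hxD hiso) hL
    (CoConnected.of_isolated hxD hiso) link_subset subset_rfl (HasType.of_isolated hxD hiso)
  rwa [List.append_nil] at this

lemma IsWedge.of_leaf (hS : S.Finite) (hx : x ∈ S) (hy : y ∈ S) (hxy : G.Adj x y)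
    (hleaf : ∀ z ∈ S, G.Adj x z → z = y)
    (hL : link G S y = ∅ ∨ IsWedge G (link G S y)) : IsWedge G S := by
  rcases hL with hL | ⟨l, ds, hL⟩
  · exact ⟨y, _, HasType.attach_of_link_empty hS hy hL (HasType.of_isolated
      (⟨hx, hxy.ne⟩ : x ∈ S \ {y}) fun z hz h => hz.2 (hleaf z hz.1 h))⟩
  · exact ⟨x, _, HasType.of_leaf hS hx hy hxy hleaf hL⟩

lemma IsContr.of_leaf (hS : S.Finite) (hx : x ∈ S) (hy : y ∈ S) (hxy : G.Adj x y)
    (hleaf : ∀ z ∈ S, G.Adj x z → z = y) (hL : IsContr G (link G S y)) : IsContr G S :=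
  let ⟨_, hL⟩ := hL
  ⟨x, HasType.of_leaf hS hx hy hxy hleaf hL⟩

namespace InducedPath

lemma isContr (h : InducedPath G R p N) (hR : R.Finite) (hβ : β ≤ N) {k : ℕ}
    (hk : β = α + 3 * k + 1) : IsContr G (R ∪ p '' Set.Ico α β) := by
  induction k generalizing β with
  | zero =>
    subst hk
    exact IsContr.of_isolated (Or.inr ⟨α, by simp, rfl⟩) (h.single_isolated hβ)
  | succ k ih =>
    obtain ⟨h1, h2, h3, h4, h5⟩ := h.leaf hβ (α := α) (by omega)
    refine IsContr.of_leaf (hR.union ((Set.finite_Ico _ _).image p)) h1 h2 h3 h4 ?_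
    rw [h5]
    exact ih (by omega) (by omega)

lemma isWedge (h : InducedPath G R p N) (hR : R.Finite) (hβ : β ≤ N)
    (hRw : R = ∅ ∨ IsWedge G R) :
    R ∪ p '' Set.Ico α β = ∅ ∨ IsWedge G (R ∪ p '' Set.Ico α β) := by
  induction β using Nat.strong_induction_on with
  | _ β ih =>
    rcases le_or_gt β α with h0 | h0
    · simpa [Set.Ico_eq_empty_of_le h0] using hRw
    · refine Or.inr ?_
      rcases eq_or_lt_of_le (Nat.succ_le_of_lt h0) with h1 | h1
      · exact (h.isContr hR hβ (k := 0) h1.symm).isWedge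
      · obtain ⟨h1, h2, h3, h4, h5⟩ := h.leaf hβ (α := α) (by omega)
        refine IsWedge.of_leaf (hR.union ((Set.finite_Ico _ _).image p)) h1 h2 h3 h4 ?_
        rw [h5]
        exact ih _ (by omega) (by omega)

end InducedPath

end Rules

/-! ## Line graphs of polygonal line tilings -/

/-- Names for the edges of a polygonal line tiling: `a i` is the `i`-th shared edge, and the
`b σ i` with `i ≥ 1` are the consecutive edges of the top or bottom boundary path. -/
inductive LV : Type
  | a : ℕ → LV
  | b : Bool → ℕ → LV
deriving DecidableEq

namespace LV

/-- Adjacency of edges, each polygon contributing `m` edges to either boundary path. -/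
def Adj (m : ℕ) : LV → LV → Prop
  | a _, a _ => False
  | a i, b _ j => j = i * m ∨ j = i * m + 1
  | b _ j, a i => j = i * m ∨ j = i * m + 1
  | b σ i, b τ j => σ = τ ∧ (j = i + 1 ∨ i = j + 1)

/-- The graph of all edge names. -/
def graph (m : ℕ) : SimpleGraph LV where
  Adj := Adj m
  symm := ⟨by
    rintro (i | ⟨σ, i⟩) (j | ⟨τ, j⟩) h
    · exact h
    · exact h
    · exact h
    · exact ⟨h.1.symm, h.2.symm⟩⟩
  loopless := ⟨by
    rintro (i | ⟨σ, i⟩) h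
    · exact h
    · have := h.2
      omega⟩

variable {m s c r K N B α β i j : ℕ} {σ τ : Bool} {x : Bool → ℕ} {F : ℕ → ℕ}

@[simp] lemma adj_a_a : (graph m).Adj (a i) (a j) ↔ False := Iff.rfl

@[simp] lemma adj_a_b : (graph m).Adj (a i) (b σ j) ↔ j = i * m ∨ j = i * m + 1 := Iff.rfl

@[simp] lemma adj_b_a : (graph m).Adj (b σ j) (a i) ↔ j = i * m ∨ j = i * m + 1 := Iff.rfl

@[simp] lemma adj_b_b : (graph m).Adj (b σ i) (b τ j) ↔ σ = τ ∧ (j = i + 1 ∨ i = j + 1) :=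
  Iff.rfl

/-- The first `s` shared edges together with the first `x σ` edges of either boundary path. -/
def strip (s : ℕ) (x : Bool → ℕ) : Set LV :=
  {w | match w with
    | a i => i < s
    | b σ i => 1 ≤ i ∧ i ≤ x σ}

@[simp] lemma a_mem_strip : a i ∈ strip s x ↔ i < s := Iff.rfl

@[simp] lemma b_mem_strip : b σ i ∈ strip s x ↔ 1 ≤ i ∧ i ≤ x σ := Iff.rfl

lemma strip_finite (s : ℕ) (x : Bool → ℕ) : (strip s x).Finite := by
  refine (((Set.finite_Iio s).image a).union
    (Set.finite_iUnion fun σ => (Set.finite_Icc 1 (x σ)).image (b σ))).subset ?_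
  rintro (i | ⟨σ, i⟩) h
  · exact Or.inl ⟨i, h, rfl⟩
  · exact Or.inr (Set.mem_iUnion.2 ⟨σ, i, h, rfl⟩)

lemma mul_add_le (m : ℕ) (h : i < r) : i * m + m ≤ r * m := by
  rw [← Nat.succ_mul]
  exact Nat.mul_le_mul_right m h

/-- The sequence `b false (F (K - 1)), …, b false (F 0), a c, b true (F 0), b true (F 1), …`. -/
def arms (c : ℕ) (F : ℕ → ℕ) (K i : ℕ) : LV :=
  if i < K then b false (F (K - 1 - i)) else if i = K then a c else b true (F (i - K - 1))

lemma arms_cases (c : ℕ) (F : ℕ → ℕ) (K i : ℕ) :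
    (∃ k < K, i + k + 1 = K ∧ arms c F K i = b false (F k)) ∨ (i = K ∧ arms c F K i = a c) ∨
      ∃ k, i = K + k + 1 ∧ arms c F K i = b true (F k) := by
  rcases lt_trichotomy i K with h | h | h
  · exact Or.inl ⟨K - 1 - i, by omega, by omega, if_pos h⟩
  · exact Or.inr (Or.inl ⟨h, by simp [arms, h]⟩)
  · refine Or.inr (Or.inr ⟨i - K - 1, by omega, ?_⟩)
    rw [arms, if_neg (by omega), if_neg (by omega)]

lemma a_mem_arms : a i ∈ arms c F K '' Set.Ico α β ↔ i = c ∧ α ≤ K ∧ K < β := by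
  constructor
  · rintro ⟨j, hj, h⟩
    have := hj.1
    have := hj.2
    rcases arms_cases c F K j with ⟨k, hk, h1, h2⟩ | ⟨h1, h2⟩ | ⟨k, h1, h2⟩ <;> rw [h] at h2
    · cases h2
    · cases h2
      omega
    · cases h2
  · rintro ⟨rfl, h⟩
    exact ⟨K, h, by simp [arms]⟩

lemma b_false_mem_arms : b false i ∈ arms c F K '' Set.Ico α β ↔
    ∃ k, k + α + 1 ≤ K ∧ K < β + k + 1 ∧ i = F k := by
  constructor
  · rintro ⟨j, hj, h⟩
    have := hj.1
    have := hj.2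
    rcases arms_cases c F K j with ⟨k, hk, h1, h2⟩ | ⟨h1, h2⟩ | ⟨k, h1, h2⟩ <;> rw [h] at h2
    · cases h2
      exact ⟨k, by omega, by omega, rfl⟩
    · cases h2
    · cases h2
  · rintro ⟨k, h1, h2, rfl⟩
    refine ⟨K - 1 - k, ⟨by omega, by omega⟩, ?_⟩
    rw [arms, if_pos (by omega), show K - 1 - (K - 1 - k) = k by omega]

lemma b_true_mem_arms : b true i ∈ arms c F K '' Set.Ico α β ↔
    ∃ k, α ≤ K + k + 1 ∧ K + k + 1 < β ∧ i = F k := by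
  constructor
  · rintro ⟨j, hj, h⟩
    have := hj.1
    have := hj.2
    rcases arms_cases c F K j with ⟨k, hk, h1, h2⟩ | ⟨h1, h2⟩ | ⟨k, h1, h2⟩ <;> rw [h] at h2
    · cases h2
    · cases h2
    · cases h2
      exact ⟨k, by omega, by omega, rfl⟩
  · rintro ⟨k, h1, h2, rfl⟩
    refine ⟨K + k + 1, ⟨by omega, by omega⟩, ?_⟩
    rw [arms, if_neg (by omega), if_neg (by omega), show K + k + 1 - K - 1 = k by omega]

lemma inducedPath_arms {R : Set LV} (hK : K ≤ B) (hN : N ≤ K + 1 + B)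
    (hF : ∀ k < B, ∀ l < B, F k = F l → k = l)
    (hFF : ∀ k < B, ∀ l < B, (F l = F k + 1 ∨ F k = F l + 1) ↔ (l = k + 1 ∨ k = l + 1))
    (hc : ∀ k < B, (F k = c * m ∨ F k = c * m + 1) ↔ k = 0)
    (hR : ∀ z ∈ R, z ≠ a c ∧ ¬ (graph m).Adj (a c) z ∧
      ∀ σ, ∀ k < B, z ≠ b σ (F k) ∧ ¬ (graph m).Adj (b σ (F k)) z) :
    InducedPath (graph m) R (arms c F K) N := by
  have cases : ∀ i < N, (∃ k < B, i + k + 1 = K ∧ arms c F K i = b false (F k)) ∨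
      (i = K ∧ arms c F K i = a c) ∨ ∃ k < B, i = K + k + 1 ∧ arms c F K i = b true (F k) := by
    intro i hi
    rcases arms_cases c F K i with ⟨k, hk, h⟩ | h | ⟨k, h⟩
    · exact Or.inl ⟨k, by omega, h⟩
    · exact Or.inr (Or.inl h)
    · exact Or.inr (Or.inr ⟨k, by omega, h⟩)
  refine ⟨fun i hi j hj h => ?_, fun i hi j hj => ?_, fun i hi hmem => ?_, fun i hi z hz => ?_⟩
  · rcases cases i hi with ⟨k, hk, h1, h2⟩ | ⟨h1, h2⟩ | ⟨k, hk, h1, h2⟩ <;>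
    rcases cases j hj with ⟨l, hl, h3, h4⟩ | ⟨h3, h4⟩ | ⟨l, hl, h3, h4⟩ <;>
    rw [h2, h4] at h
    · have := hF k hk l hl (by injection h)
      omega
    · cases h
    · cases h
    · cases h
    · omega
    · cases h
    · cases h
    · cases h
    · have := hF k hk l hl (by injection h)
      omega
  · rcases cases i hi with ⟨k, hk, h1, h2⟩ | ⟨h1, h2⟩ | ⟨k, hk, h1, h2⟩ <;>
    rcases cases j hj with ⟨l, hl, h3, h4⟩ | ⟨h3, h4⟩ | ⟨l, hl, h3, h4⟩ <;>
    rw [h2, h4]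
    · rw [adj_b_b, hFF k hk l hl, eq_self_iff_true, true_and]
      omega
    · rw [adj_b_a, hc k hk]
      omega
    · rw [adj_b_b]
      simp
      omega
    · rw [adj_a_b, hc l hl]
      omega
    · rw [adj_a_a, false_iff]
      omega
    · rw [adj_a_b, hc l hl]
      omega
    · rw [adj_b_b]
      simp
      omega
    · rw [adj_b_a, hc k hk]
      omega
    · rw [adj_b_b, hFF k hk l hl, eq_self_iff_true, true_and]
      omega
  · rcases cases i hi with ⟨k, hk, h1, h2⟩ | ⟨h1, h2⟩ | ⟨k, hk, h1, h2⟩ <;> rw [h2] at hmem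
    · exact ((hR _ hmem).2.2 false k hk).1 rfl
    · exact (hR _ hmem).1 rfl
    · exact ((hR _ hmem).2.2 true k hk).1 rfl
  · rcases cases i hi with ⟨k, hk, h1, h2⟩ | ⟨h1, h2⟩ | ⟨k, hk, h1, h2⟩ <;> rw [h2]
    · exact ((hR z hz).2.2 false k hk).2
    · exact (hR z hz).2.1
    · exact ((hR z hz).2.2 true k hk).2

/-- A single shared edge with its two boundary paths. -/
lemma strip_one (m : ℕ) (x : Bool → ℕ) : IsWedge (graph m) (strip 1 x) ∧
    (3 ≤ x false + x true → CoConnected (graph m) (strip 1 x)) := by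
  have hp : InducedPath (graph m) ∅ (arms 0 (· + 1) (x false)) (x false + x true + 1) :=
    inducedPath_arms (B := x false + x true) (by omega) (by omega) (by intros; omega)
      (by intros; omega) (by intros; omega) (fun z hz => hz.elim)
  have he : strip 1 x = ∅ ∪ arms 0 (· + 1) (x false) '' Set.Ico 0 (x false + x true + 1) := by
    ext z
    rw [Set.empty_union]
    rcases z with i | ⟨_ | _, i⟩
    · rw [a_mem_arms, a_mem_strip]
      omega
    · rw [b_false_mem_arms, b_mem_strip]
      exact ⟨fun h => ⟨i - 1, by omega⟩, fun ⟨k, hk⟩ => by omega⟩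
    · rw [b_true_mem_arms, b_mem_strip]
      exact ⟨fun h => ⟨i - 1, by omega⟩, fun ⟨k, hk⟩ => by omega⟩
  rw [he]
  refine ⟨(hp.isWedge Set.finite_empty le_rfl (Or.inl rfl)).resolve_left ?_,
    fun h => hp.coConnected le_rfl (by omega)⟩
  rw [← he]
  exact fun h => (h ▸ (by simp : a 0 ∈ strip 1 x) : a 0 ∈ (∅ : Set LV))

/-- Removing three edges from the end of a long boundary path. -/
lemma strip_leaf (hx : s * m + 3 ≤ x σ)
    (h : IsWedge (graph m) (strip (s + 1) (Function.update x σ (x σ - 3)))) :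
    IsWedge (graph m) (strip (s + 1) x) ∧ CoConnected (graph m) (strip (s + 1) x) := by
  have hbound : ∀ i < s + 1, i * m ≤ s * m := fun i hi => Nat.mul_le_mul_right m (by omega)
  have hx1 : b σ (x σ) ∈ strip (s + 1) x := ⟨by omega, le_rfl⟩
  have hy1 : b σ (x σ - 1) ∈ strip (s + 1) x := ⟨by omega, by omega⟩
  have hxy : (graph m).Adj (b σ (x σ)) (b σ (x σ - 1)) := ⟨rfl, by omega⟩
  have hleaf : ∀ z ∈ strip (s + 1) x, (graph m).Adj (b σ (x σ)) z → z = b σ (x σ - 1) := by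
    rintro (i | ⟨τ, i⟩) hz hadj
    · have := hbound i hz
      rw [adj_b_a] at hadj
      omega
    · obtain ⟨rfl, hadj⟩ := hadj
      have := hz.2
      congr 1
      omega
  have hL : link (graph m) (strip (s + 1) x) (b σ (x σ - 1)) =
      strip (s + 1) (Function.update x σ (x σ - 3)) := by
    ext z
    rcases z with i | ⟨τ, i⟩
    · refine ⟨fun hz => hz.1, fun hz => ⟨hz, by simp, ?_⟩⟩
      have := hbound i hz
      rw [adj_b_a]
      omega
    · change b τ i ∈ strip (s + 1) x ∧ b τ i ≠ b σ (x σ - 1) ∧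
        ¬ (graph m).Adj (b σ (x σ - 1)) (b τ i) ↔ _
      by_cases hτ : τ = σ
      · subst hτ
        simp
        omega
      · simp [hτ, Ne.symm hτ]
  rw [← hL] at h
  exact ⟨IsWedge.of_leaf (strip_finite _ _) hx1 hy1 hxy hleaf (Or.inr h),
    CoConnected.of_leaf hx1 hy1 hxy hleaf h.nonempty⟩

lemma strip_sdiff (s : ℕ) (x : Bool → ℕ) : strip (s + 1) x \ {a s} = strip s x := by
  ext z
  rcases z with i | ⟨τ, i⟩
  · simp
    omega
  · simp

/-- The part of a strip beyond a shared edge `a r` that is missing from the strip. -/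
lemma inducedPath_gap (hr : r < c) (hm : 1 ≤ m) (hK : K + r * m = c * m) :
    InducedPath (graph m) (strip r fun _ => r * m - 1) (arms c (c * m - ·) K)
      (2 * K + 1) := by
  have hrc := mul_add_le m hr
  refine inducedPath_arms (B := K) le_rfl (by omega) (by intros; omega) (by intros; omega)
    (by intros; omega) ?_
  rintro (i | ⟨τ, i⟩) hz
  · have := mul_add_le m (a_mem_strip.1 hz)
    have := a_mem_strip.1 hz
    refine ⟨fun h => ?_, by simp, fun σ k hk => ⟨by simp, ?_⟩⟩
    · injection h
      omega
    · rw [adj_b_a]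
      omega
  · have := b_mem_strip.1 hz
    refine ⟨by simp, ?_, fun σ k hk => ⟨fun h => ?_, ?_⟩⟩
    · rw [adj_a_b]
      omega
    · injection h
      omega
    · rw [adj_b_b]
      omega

/-- The strip with a further shared edge `a c`. -/
def stripAdd (m c r : ℕ) : Set LV := strip r (fun _ => c * m) ∪ {a c}

lemma stripAdd_finite (m c r : ℕ) : (stripAdd m c r).Finite :=
  (strip_finite _ _).union (Set.finite_singleton _)

lemma a_mem_stripAdd : a i ∈ stripAdd m c r ↔ i < r ∨ i = c := by simp [stripAdd, or_comm]

lemma b_mem_stripAdd : b σ i ∈ stripAdd m c r ↔ 1 ≤ i ∧ i ≤ c * m := by simp [stripAdd]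

lemma stripAdd_sdiff (hr : r < c) : stripAdd m c (r + 1) \ {a r} = stripAdd m c r := by
  ext z
  rcases z with i | ⟨τ, i⟩
  · rw [Set.mem_sdiff, a_mem_stripAdd, a_mem_stripAdd, Set.mem_singleton_iff, a.injEq]
    omega
  · simp [b_mem_stripAdd]

lemma stripAdd_zero (m c : ℕ) : stripAdd m c 0 =
    (strip 0 fun _ => 0 * m - 1) ∪ arms c (c * m - ·) (c * m) '' Set.Ico 0 (2 * (c * m) + 1) := by
  ext z
  rcases z with i | ⟨_ | _, i⟩
  · rw [Set.mem_union, a_mem_arms, a_mem_strip, a_mem_stripAdd]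
    omega
  · rw [Set.mem_union, b_false_mem_arms, b_mem_strip, b_mem_stripAdd]
    exact ⟨fun h => Or.inr ⟨c * m - i, by omega⟩, by rintro (h | ⟨k, hk⟩) <;> omega⟩
  · rw [Set.mem_union, b_true_mem_arms, b_mem_strip, b_mem_stripAdd]
    exact ⟨fun h => Or.inr ⟨c * m - i, by omega⟩, by rintro (h | ⟨k, hk⟩) <;> omega⟩

lemma link_stripAdd (hr : r < c) (hm : 1 ≤ m) (hK : K + r * m = c * m) :
    link (graph m) (stripAdd m c (r + 1)) (a r) =
      (strip r fun _ => r * m - 1) ∪ arms c (c * m - ·) K '' Set.Ico 1 (2 * K) := by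
  have hrc := mul_add_le m hr
  ext z
  rcases z with i | ⟨_ | _, i⟩
  · rw [Set.mem_union, a_mem_arms, a_mem_strip]
    change a i ∈ _ ∧ a i ≠ a r ∧ ¬ False ↔ _
    rw [a_mem_stripAdd, ne_eq, a.injEq, not_false_iff, and_true]
    omega
  · rw [Set.mem_union, b_false_mem_arms, b_mem_strip]
    change b _ i ∈ _ ∧ b _ i ≠ a r ∧ ¬ (i = r * m ∨ i = r * m + 1) ↔ _
    rw [b_mem_stripAdd]
    constructor
    · rintro ⟨h1, -, h2⟩
      by_cases h : i < r * m
      · left; omega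
      · exact Or.inr ⟨c * m - i, by omega⟩
    · rintro (h | ⟨k, hk⟩) <;> exact ⟨by omega, by simp, by omega⟩
  · rw [Set.mem_union, b_true_mem_arms, b_mem_strip]
    change b _ i ∈ _ ∧ b _ i ≠ a r ∧ ¬ (i = r * m ∨ i = r * m + 1) ↔ _
    rw [b_mem_stripAdd]
    constructor
    · rintro ⟨h1, -, h2⟩
      by_cases h : i < r * m
      · left; omega
      · exact Or.inr ⟨c * m - i, by omega⟩
    · rintro (h | ⟨k, hk⟩) <;> exact ⟨by omega, by simp, by omega⟩

lemma union_arms_subset (hK : K + r * m = c * m) (hβ : β ≤ 2 * K + 1) :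
    (strip r fun _ => r * m - 1) ∪ arms c (c * m - ·) K '' Set.Ico α β ⊆ stripAdd m c r := by
  intro z
  rcases z with i | ⟨_ | _, i⟩
  · rw [Set.mem_union, a_mem_arms, a_mem_strip, a_mem_stripAdd]
    omega
  · rw [Set.mem_union, b_false_mem_arms, b_mem_strip, b_mem_stripAdd]
    rintro (h | ⟨k, hk⟩) <;> omega
  · rw [Set.mem_union, b_true_mem_arms, b_mem_strip, b_mem_stripAdd]
    rintro (h | ⟨k, hk⟩) <;> omega

lemma stripAdd_isWedge (hm : 1 ≤ m) (hc : 2 ≤ c * m)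
    (ih : ∀ r, 1 ≤ r → r < c → IsWedge (graph m) (strip r fun _ => r * m - 1)) (hr : r ≤ c) :
    IsWedge (graph m) (stripAdd m c r) ∧ CoConnected (graph m) (stripAdd m c r) := by
  have ih' : ∀ r < c, (strip r fun _ => r * m - 1) = ∅ ∨
      IsWedge (graph m) (strip r fun _ => r * m - 1) := by
    intro r hr
    rcases Nat.eq_zero_or_pos r with rfl | h
    · left
      ext z
      rcases z with i | ⟨_, i⟩
      · simp
      · simp
        omega
    · exact Or.inr (ih r h hr)
  induction r with
  | zero =>
    have h0 : 0 < c := Nat.pos_of_ne_zero (by rintro rfl; omega)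
    have hp := inducedPath_gap (K := c * m) h0 hm (by omega)
    rw [stripAdd_zero]
    refine ⟨(hp.isWedge (strip_finite _ _) le_rfl (ih' 0 h0)).resolve_left ?_,
      hp.coConnected le_rfl (by omega)⟩
    rw [← stripAdd_zero]
    exact Set.Nonempty.ne_empty ⟨a c, a_mem_stripAdd.2 (Or.inr rfl)⟩
  | succ r ihr =>
    obtain ⟨hD, hconn⟩ := ihr (by omega)
    obtain ⟨K, hK⟩ : ∃ K, K + r * m = c * m :=
      ⟨c * m - r * m, Nat.sub_add_cancel (Nat.mul_le_mul_right m (by omega))⟩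
    have hrc := mul_add_le m hr
    have hp := inducedPath_gap hr hm hK
    have hL := link_stripAdd hr hm hK
    have hac : a c ∈ link (graph m) (stripAdd m c (r + 1)) (a r) := by
      rw [hL, Set.mem_union, a_mem_arms]
      omega
    have hv : a r ∈ stripAdd m c (r + 1) := a_mem_stripAdd.2 (by omega)
    have hLw : IsWedge (graph m) (link (graph m) (stripAdd m c (r + 1)) (a r)) := by
      have := hp.isWedge (strip_finite _ _) (show 2 * K ≤ 2 * K + 1 by omega) (ih' r hr) (α := 1)
      rw [← hL] at this
      exact this.resolve_left (Set.Nonempty.ne_empty ⟨_, hac⟩)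
    rw [← stripAdd_sdiff hr] at hD hconn
    refine ⟨?_, CoConnected.of_sdiff hv hconn ⟨_, hac⟩⟩
    obtain ⟨α, β, k, hα, hβ, hk, hβ'⟩ : ∃ α β k, α ≤ 1 ∧ 2 * K ≤ β ∧ β = α + 3 * k + 1 ∧
        β ≤ 2 * K + 1 := by
      obtain h | h | h : (2 * K + 1) % 3 = 0 ∨ (2 * K + 1) % 3 = 1 ∨ (2 * K + 1) % 3 = 2 := by
        omega
      · exact ⟨1, 2 * K, (2 * K - 2) / 3, by omega⟩
      · exact ⟨0, 2 * K + 1, 2 * K / 3, by omega⟩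
      · exact ⟨0, 2 * K, (2 * K - 1) / 3, by omega⟩
    refine IsWedge.attach (stripAdd_finite _ _ _) hv hD hLw hconn ?_ ?_
      (hp.isContr (strip_finite _ _) hβ' hk)
    · rw [hL]
      exact Set.union_subset_union_right _ (Set.image_mono (Set.Ico_subset_Ico hα hβ))
    · rw [stripAdd_sdiff hr]
      exact union_arms_subset hK hβ'

/-- The exceptional strip, a cycle with four vertices. -/
lemma stripAdd_one_isWedge : IsWedge (graph 1) (stripAdd 1 1 1) := by
  have hS := stripAdd_finite 1 1 1
  have h0 : a 0 ∈ stripAdd 1 1 1 := a_mem_stripAdd.2 (by omega)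
  have hD : HasType (graph 1) (stripAdd 1 1 1 \ {a 0}) (a 1) [0] := by
    have hDS := stripAdd_sdiff (m := 1) (c := 1) (r := 0) one_pos
    rw [zero_add] at hDS
    rw [hDS]
    have h1 : b false 1 ∈ stripAdd 1 1 0 \ {a 1} := ⟨b_mem_stripAdd.2 (by omega), by simp⟩
    refine HasType.attach_of_link_empty (stripAdd_finite _ _ _) (a_mem_stripAdd.2 (by omega))
      ?_ (HasType.of_isolated h1 ?_)
    · ext z
      rcases z with i | ⟨τ, i⟩
      · simp [link, a_mem_stripAdd]
      · simp [link, b_mem_stripAdd]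
        omega
    · rintro (i | ⟨τ, i⟩) ⟨hz, hz'⟩
      · have := a_mem_stripAdd.1 hz
        refine (hz' ?_).elim
        obtain rfl : i = 1 := by omega
        rfl
      · have := b_mem_stripAdd.1 hz
        rw [adj_b_b]
        omega
  have hL : link (graph 1) (stripAdd 1 1 1) (a 0) = {a 1} := by
    ext z
    rcases z with i | ⟨τ, i⟩
    · simp [link, a_mem_stripAdd]
      omega
    · simp [link, b_mem_stripAdd]
      omega
  have h1 : a 1 ∈ link (graph 1) (stripAdd 1 1 1) (a 0) := hL ▸ rfl
  have hLt : HasType (graph 1) (link (graph 1) (stripAdd 1 1 1) (a 0)) (a 1) [] := by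
    refine HasType.of_isolated h1 fun z hz => ?_
    rw [hL] at hz
    rw [hz]
    exact id
  refine ⟨_, _, HasType.attach_of_homotopic hS h0 hD hLt ?_⟩
  have hc : linkIncl (graph 1) (stripAdd 1 1 1) (a 0) =
      ContinuousMap.const _ (geomPt (a 1) (singleton_mem_indOn _ hD.1)) := by
    refine ContinuousMap.ext fun f => geom.eq_geomPt ?_ (singleton_mem_indOn _ hD.1)
    obtain ⟨s, hs, hf⟩ := f.2.1
    have hsupp : ∀ w, f.1 w ≠ 0 → w ∈ ({a 1} : Finset LV) := by
      intro w hw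
      have := hs.1 (hf w hw)
      rw [hL] at this
      exact Finset.mem_singleton.2 this
    have h2 := f.2.2.2
    rw [geom.finsum_eq_of_support hsupp, Finset.sum_singleton] at h2
    exact h2
  rw [hc]

/-- The link of the last shared edge of a strip. -/
lemma mem_link_strip_b (s : ℕ) (x : Bool → ℕ) :
    b σ i ∈ link (graph m) (strip (s + 1) x) (a s) ↔
      1 ≤ i ∧ i ≤ x σ ∧ i ≠ s * m ∧ i ≠ s * m + 1 := by
  simp [link, and_assoc]
  tauto

lemma mem_link_strip_a (s : ℕ) (x : Bool → ℕ) :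
    a i ∈ link (graph m) (strip (s + 1) x) (a s) ↔ i < s := by
  simp [link]
  omega

/-- The complexes of strips are wedges of spheres, and all but the shortest ones are
connected. -/
theorem strip_isWedge (hm : 1 ≤ m) (s : ℕ) (x : Bool → ℕ) (hx : ∀ σ, s * m ≤ x σ) :
    IsWedge (graph m) (strip (s + 1) x) ∧
      (2 * (s * m) + 3 ≤ x false + x true → CoConnected (graph m) (strip (s + 1) x)) := by
  induction s using Nat.strong_induction_on generalizing x with
  | _ s ihs =>
  rcases s with _ | s
  · have := strip_one m x
    simpa using this
  obtain ⟨n, hn⟩ : ∃ n, n = x false + x true := ⟨_, rfl⟩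
  induction n using Nat.strong_induction_on generalizing x with
  | _ n ihn =>
  by_cases h3 : ∃ σ, (s + 1) * m + 3 ≤ x σ
  · obtain ⟨σ, hσ⟩ := h3
    have h := strip_leaf hσ (ihn _ ?_ _ (fun τ => ?_) rfl).1
    · exact ⟨h.1, fun _ => h.2⟩
    · rcases σ <;> simp <;> omega
    · rcases eq_or_ne τ σ with rfl | hτ
      · simp
        omega
      · simpa [hτ] using hx τ
  have hsm := mul_add_le m s.lt_succ_self
  rw [Nat.succ_eq_add_one] at hsm
  have hle : ∀ σ, x σ ≤ (s + 1) * m + 2 := fun σ => by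
    by_contra h
    exact h3 ⟨σ, by omega⟩
  have hxf := hx false
  have hxt := hx true
  by_cases h1 : ∃ σ, (s + 1) * m + 1 ≤ x σ
  · obtain ⟨σ, hσ⟩ := h1
    have hs0 : 0 < s + 1 := by omega
    have hv : a (s + 1) ∈ strip (s + 1 + 1) x := by simp
    have ih := ihs s (by omega) x (fun σ => by have := hx σ; omega)
    have hsum : 2 * (s * m) + 3 ≤ x false + x true := by
      rcases σ <;> omega
    have hconn := ih.2 hsum
    have hD := ih.1
    rw [← strip_sdiff (s + 1)] at hD hconn
    have hL0 : a 0 ∈ link (graph m) (strip (s + 1 + 1) x) (a (s + 1)) :=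
      (mem_link_strip_a _ _).2 hs0
    refine ⟨?_, fun _ => CoConnected.of_sdiff hv hconn ⟨_, hL0⟩⟩
    by_cases h2 : ∃ σ, x σ = (s + 1) * m + 2
    · obtain ⟨τ, hτ⟩ := h2
      have hLc : IsContr (graph m) (link (graph m) (strip (s + 1 + 1) x) (a (s + 1))) := by
        refine IsContr.of_isolated (v := b τ (x τ)) ((mem_link_strip_b _ _).2 (by omega)) ?_
        rintro (i | ⟨ρ, i⟩) hz
        · have := mul_add_le m ((mem_link_strip_a _ _).1 hz)
          rw [adj_b_a]
          omega
        · have := (mem_link_strip_b _ _).1 hz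
          rw [adj_b_b]
          rintro ⟨rfl, h⟩
          omega
      exact IsWedge.attach (strip_finite _ _) hv hD hLc.isWedge hconn subset_rfl link_subset hLc
    · have hL : link (graph m) (strip (s + 1 + 1) x) (a (s + 1)) =
          strip (s + 1) fun _ => (s + 1) * m - 1 := by
        ext z
        rcases z with i | ⟨τ, i⟩
        · rw [mem_link_strip_a, a_mem_strip]
        · have := hle τ
          have := hx τ
          have : x τ ≠ (s + 1) * m + 2 := fun h => h2 ⟨τ, h⟩
          rw [mem_link_strip_b, b_mem_strip]
          omega
      have hLw := (ihs s (by omega) (fun _ => (s + 1) * m - 1) (fun _ => by omega)).1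
      rw [← hL] at hLw
      refine IsWedge.attach (strip_finite _ _) hv hD hLw hconn
        (R := insert (b σ ((s + 1) * m + 1)) (link (graph m) (strip (s + 1 + 1) x) (a (s + 1))))
        (Set.subset_insert _ _)
        (Set.insert_subset ⟨b_mem_strip.2 (by omega), by simp⟩ link_subset)
        (IsContr.of_isolated (Set.mem_insert _ _) ?_)
      rintro z (rfl | hz)
      · exact (graph m).irrefl
      · rw [hL] at hz
        rcases z with i | ⟨ρ, i⟩
        · have := mul_add_le m (a_mem_strip.1 hz)
          rw [adj_b_a]
          omega
        · have := b_mem_strip.1 hz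
          rw [adj_b_b]
          omega
  · have hxc : ∀ σ, x σ = (s + 1) * m := fun σ => by
      have := hx σ
      by_contra h
      exact h1 ⟨σ, by omega⟩
    refine ⟨?_, fun h => by rw [hxc, hxc] at h; omega⟩
    have hS : strip (s + 1 + 1) x = stripAdd m (s + 1) (s + 1) := by
      ext z
      rcases z with i | ⟨τ, i⟩
      · rw [a_mem_stripAdd, a_mem_strip]
        omega
      · rw [b_mem_stripAdd, b_mem_strip, hxc]
    rw [hS]
    by_cases h2 : 2 ≤ (s + 1) * m
    · refine (stripAdd_isWedge hm h2 (fun r h1 hr => ?_) le_rfl).1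
      obtain ⟨r, rfl⟩ : ∃ q, r = q + 1 := ⟨r - 1, by omega⟩
      have := mul_add_le m r.lt_succ_self
      rw [Nat.succ_eq_add_one] at this
      exact (ihs r (by omega) (fun _ => (r + 1) * m - 1) (fun _ => by omega)).1
    · obtain rfl : m = 1 := by omega
      obtain rfl : s = 0 := by omega
      exact stripAdd_one_isWedge

end LV

/-! ## Transfer to matching complexes -/

/-- The map of realizations induced by a bijection between vertex sets. -/
noncomputable def geom.pull {V W : Type} {K : Set (Finset V)} {K' : Set (Finset W)} {S : Set V}
    {T : Set W} (φ : W → V) (hφ : Set.BijOn φ T S) (hK : ∀ s ∈ K, (↑s : Set V) ⊆ S)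
    (h : ∀ s ∈ K, ∃ s' ∈ K', ∀ w ∈ T, φ w ∈ s → w ∈ s') : C(geom K, geom K') where
  toFun f := ⟨T.indicator (f.1 ∘ φ), by
      obtain ⟨s, hs, hf⟩ := f.2.1
      obtain ⟨s', hs', h⟩ := h s hs
      refine ⟨s', hs', fun w hw => ?_⟩
      rw [Set.indicator_apply_ne_zero] at hw
      exact h w hw.1 (hf _ hw.2),
    fun w => Set.indicator_nonneg (fun w _ => f.2.2.1 (φ w)) w, by
      obtain ⟨s, hs, hf⟩ := f.2.1
      rw [← finsum_mem_def, finsum_mem_eq_of_bijOn (f := f.1 ∘ φ) (g := f.1) φ hφ fun _ _ => rfl]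
      rw [finsum_mem_def, Set.indicator_eq_self.2 fun v hv => hK s hs (hf v hv)]
      exact f.2.2.2⟩
  continuous_toFun := by
    refine Continuous.subtype_mk (continuous_pi fun w => ?_) _
    by_cases hw : w ∈ T
    · simp only [Set.indicator_of_mem hw]
      exact geom.continuous_eval (φ w)
    · simp only [Set.indicator_of_notMem hw]
      exact continuous_const

lemma geom.pull_pull {V W : Type} {K : Set (Finset V)} {K' : Set (Finset W)} {S : Set V}
    {T : Set W} {φ : W → V} {ψ : V → W} (hφ : Set.BijOn φ T S) (hψ : Set.BijOn ψ S T)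
    (hK : ∀ s ∈ K, (↑s : Set V) ⊆ S) (hK' : ∀ s ∈ K', (↑s : Set W) ⊆ T)
    (h : ∀ s ∈ K, ∃ s' ∈ K', ∀ w ∈ T, φ w ∈ s → w ∈ s')
    (h' : ∀ s ∈ K', ∃ s' ∈ K, ∀ v ∈ S, ψ v ∈ s → v ∈ s')
    (hφψ : ∀ v ∈ S, φ (ψ v) = v) (f : geom K) :
    geom.pull ψ hψ hK' h' (geom.pull φ hφ hK h f) = f := by
  refine Subtype.ext (funext fun v => ?_)
  change S.indicator (T.indicator (f.1 ∘ φ) ∘ ψ) v = f.1 v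
  by_cases hv : v ∈ S
  · rw [Set.indicator_of_mem hv, Function.comp_apply, Set.indicator_of_mem (hψ.mapsTo hv),
      Function.comp_apply, hφψ v hv]
  · rw [Set.indicator_of_notMem hv]
    obtain ⟨s, hs, hf⟩ := f.2.1
    by_contra hne
    exact hv (hK s hs (hf v (Ne.symm hne)))

/-- The matching complex is the independence complex of the line graph. -/
lemma matchCx_homotopyEquiv {V W : Type} {G : SimpleGraph V} {S : Set V} {P : SimpleGraph W}
    {e : V → Sym2 W} (he : Set.BijOn e S P.edgeSet)
    (hadj : ∀ x ∈ S, ∀ y ∈ S, G.Adj x y ↔ x ≠ y ∧ ∃ z, z ∈ e x ∧ z ∈ e y) :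
    Nonempty (ContinuousMap.HomotopyEquiv (geom (matchCx P)) (geom (indOn G S))) := by
  classical
  rcases isEmpty_or_nonempty V with hV | hV
  · have h1 : ∀ f : geom (indOn G S), False := fun f => by
      have := f.2.2.2
      rw [finsum_of_isEmpty] at this
      exact zero_ne_one this
    have h2 : ∀ f : geom (matchCx P), False := fun f => by
      have h3 : f.1 = 0 := funext fun w => by
        obtain ⟨s, hs, hf⟩ := f.2.1
        by_contra hw
        obtain ⟨x, -, -⟩ := he.surjOn (hs.1 (hf w hw))
        exact hV.elim x
      have := f.2.2.2
      rw [h3] at this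
      simp at this
    exact ⟨⟨⟨fun f => (h2 f).elim, continuous_of_const fun f => (h2 f).elim⟩,
      ⟨fun f => (h1 f).elim, continuous_of_const fun f => (h1 f).elim⟩, by
        rw [show ContinuousMap.comp _ _ = ContinuousMap.id _ from
          ContinuousMap.ext fun f => (h2 f).elim], by
        rw [show ContinuousMap.comp _ _ = ContinuousMap.id _ from
          ContinuousMap.ext fun f => (h1 f).elim]⟩⟩
  have hinv := he.invOn_invFunOn
  have he' : Set.BijOn (Function.invFunOn e S) P.edgeSet S :=
    Set.BijOn.symm hinv.symm he
  have h1 : ∀ s ∈ indOn G S, ∃ s' ∈ matchCx P, ∀ w ∈ P.edgeSet,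
      Function.invFunOn e S w ∈ s → w ∈ s' := by
    refine fun s hs => ⟨s.image e, ⟨?_, ?_⟩, fun w hw h =>
      Finset.mem_image.2 ⟨_, h, hinv.2 hw⟩⟩
    · rw [Finset.coe_image]
      exact (Set.image_mono hs.1).trans he.image_eq.subset
    · rintro E hE E' hE' hne z hz hz'
      obtain ⟨x, hx, rfl⟩ := Finset.mem_image.1 hE
      obtain ⟨y, hy, rfl⟩ := Finset.mem_image.1 hE'
      exact hs.2 x hx y hy ((hadj x (hs.1 hx) y (hs.1 hy)).2
        ⟨fun h => hne (h ▸ rfl), z, hz, hz'⟩)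
  have h2 : ∀ s ∈ matchCx P, ∃ s' ∈ indOn G S, ∀ v ∈ S, e v ∈ s → v ∈ s' := by
    have hback : ∀ s ∈ matchCx P, ∀ x ∈ s.image (Function.invFunOn e S), x ∈ S ∧ e x ∈ s := by
      intro s hs x hx
      obtain ⟨E, hE, rfl⟩ := Finset.mem_image.1 hx
      exact ⟨he'.mapsTo (hs.1 hE), by rwa [hinv.2 (hs.1 hE)]⟩
    refine fun s hs => ⟨s.image (Function.invFunOn e S), ⟨fun x hx => (hback s hs x hx).1, ?_⟩,
      fun v hv h => Finset.mem_image.2 ⟨_, h, hinv.1 hv⟩⟩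
    intro x hx y hy hxy
    obtain ⟨hx, hx'⟩ := hback s hs x hx
    obtain ⟨hy, hy'⟩ := hback s hs y hy
    obtain ⟨hne, z, hz, hz'⟩ := (hadj x hx y hy).1 hxy
    exact hs.2 _ hx' _ hy' (fun h => hne (he.injOn hx hy h)) z hz hz'
  have hK : ∀ s ∈ matchCx P, (↑s : Set (Sym2 W)) ⊆ P.edgeSet := fun s hs => hs.1
  have hK' : ∀ s ∈ indOn G S, (↑s : Set V) ⊆ S := fun s hs => hs.1
  refine ⟨⟨geom.pull e he hK h2, geom.pull _ he' hK' h1, ?_, ?_⟩⟩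
  · rw [show ContinuousMap.comp _ _ = ContinuousMap.id _ from ContinuousMap.ext
      (geom.pull_pull he he' hK hK' h2 h1 hinv.2)]
  · rw [show ContinuousMap.comp _ _ = ContinuousMap.id _ from ContinuousMap.ext
      (geom.pull_pull he' he hK' hK h1 h2 hinv.1)]

namespace LV

variable {m t : ℕ} {w w' : LV} {y z z' : Bool × ℕ}

/-- Incidence of edges and vertices, the vertex `(σ, k)` being the `k`-th vertex of a boundary
path. -/
def Inc (m : ℕ) : LV → Bool × ℕ → Prop
  | a i, z => z.2 = i * m
  | b σ i, z => z.1 = σ ∧ (z.2 = i ∨ z.2 + 1 = i)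

/-- Adjacency of vertices. -/
def Ladder (m : ℕ) (z z' : Bool × ℕ) : Prop :=
  (z.1 = z'.1 ∧ (z.2 + 1 = z'.2 ∨ z'.2 + 1 = z.2)) ∨ (z.1 ≠ z'.1 ∧ z.2 = z'.2 ∧ ∃ i, z.2 = i * m)

lemma exists_ladder (hw : w ∈ strip (t + 1) fun _ => t * m) :
    ∃ z z', z.2 ≤ t * m ∧ z'.2 ≤ t * m ∧ Ladder m z z' ∧ ∀ y, Inc m w y ↔ y = z ∨ y = z' := by
  rcases w with i | ⟨σ, i⟩
  · have hi : i * m ≤ t * m := Nat.mul_le_mul_right m (Nat.lt_succ_iff.1 hw)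
    refine ⟨(false, i * m), (true, i * m), hi, hi, Or.inr ⟨by simp, rfl, i, rfl⟩, ?_⟩
    rintro ⟨_ | _, k⟩ <;> simp [Inc]
  · obtain ⟨h1, h2⟩ := hw
    refine ⟨(σ, i - 1), (σ, i), (Nat.sub_le _ _).trans h2, h2,
      Or.inl ⟨rfl, Or.inl (Nat.sub_add_cancel h1)⟩, ?_⟩
    rintro ⟨τ, k⟩
    simp only [Inc, Prod.mk.injEq, ← and_or_left]
    refine and_congr_right fun _ => ?_
    omega

lemma exists_of_ladder (hm : 1 ≤ m) (hz : z.2 ≤ t * m) (hz' : z'.2 ≤ t * m)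
    (h : Ladder m z z') :
    ∃ w ∈ strip (t + 1) fun _ => t * m, ∀ y, Inc m w y ↔ y = z ∨ y = z' := by
  obtain ⟨σ, k⟩ := z
  obtain ⟨τ, l⟩ := z'
  dsimp only at hz hz'
  rcases h with ⟨h1, h⟩ | ⟨h1, h, i, hi⟩ <;> dsimp only at h1 h
  · subst h1
    refine ⟨b σ (max k l), b_mem_strip.2 (by omega), ?_⟩
    rintro ⟨τ, j⟩
    simp only [Inc, Prod.mk.injEq, ← and_or_left]
    refine and_congr_right fun _ => ?_
    omega
  · dsimp only at hi
    subst h hi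
    refine ⟨a i, a_mem_strip.2 (Nat.lt_succ_of_le (Nat.le_of_mul_le_mul_right hz hm)), ?_⟩
    rintro ⟨ρ, j⟩
    have : ρ = σ ∨ ρ = τ := by
      rcases ρ <;> rcases σ <;> rcases τ <;> simp at h1 ⊢
    simp only [Inc, Prod.mk.injEq]
    tauto

lemma eq_of_inc (hm : 1 ≤ m) (hw : w ∈ strip (t + 1) fun _ => t * m)
    (hw' : w' ∈ strip (t + 1) fun _ => t * m)
    (h : ∀ z : Bool × ℕ, z.2 ≤ t * m → (Inc m w z ↔ Inc m w' z)) : w = w' := by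
  rcases w with i | ⟨σ, i⟩ <;> rcases w' with j | ⟨τ, j⟩
  · have hi : i * m ≤ t * m := Nat.mul_le_mul_right m (Nat.lt_succ_iff.1 hw)
    have := (h (false, i * m) hi).1 rfl
    rw [Nat.eq_of_mul_eq_mul_right hm this]
  · have hi : i * m ≤ t * m := Nat.mul_le_mul_right m (Nat.lt_succ_iff.1 hw)
    have := ((h (!τ, i * m) hi).1 rfl).1
    simp at this
  · have hi : j * m ≤ t * m := Nat.mul_le_mul_right m (Nat.lt_succ_iff.1 hw')
    have := ((h (!σ, j * m) hi).2 rfl).1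
    simp at this
  · obtain ⟨h1, h2⟩ := hw
    obtain ⟨h3, h4⟩ := hw'
    have e1 := (h (σ, i) h2).1 ⟨rfl, Or.inl rfl⟩
    have e2 := (h (τ, j) h4).2 ⟨rfl, Or.inl rfl⟩
    obtain rfl : σ = τ := e1.1
    have e3 : i = j ∨ i + 1 = j := e1.2
    have e4 : j = i ∨ j + 1 = i := e2.2
    congr 1
    omega

lemma adj_iff_inc (hw : w ∈ strip (t + 1) fun _ => t * m)
    (hw' : w' ∈ strip (t + 1) fun _ => t * m) (hm : 1 ≤ m) :
    (graph m).Adj w w' ↔ w ≠ w' ∧ ∃ z : Bool × ℕ, z.2 ≤ t * m ∧ Inc m w z ∧ Inc m w' z := by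
  rcases w with i | ⟨σ, i⟩ <;> rcases w' with j | ⟨τ, j⟩
  · refine iff_of_false id ?_
    rintro ⟨h, z, -, h1, h2⟩
    exact h (congrArg a (Nat.eq_of_mul_eq_mul_right hm (h1.symm.trans h2)))
  · have hi : i * m ≤ t * m := Nat.mul_le_mul_right m (Nat.lt_succ_iff.1 hw)
    rw [adj_a_b]
    constructor
    · exact fun h => ⟨by simp, (τ, i * m), hi, rfl, rfl, by dsimp only; omega⟩
    · rintro ⟨-, z, -, h1, -, h2⟩
      rw [show z.2 = i * m from h1] at h2
      omega
  · have hi : j * m ≤ t * m := Nat.mul_le_mul_right m (Nat.lt_succ_iff.1 hw')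
    rw [adj_b_a]
    constructor
    · exact fun h => ⟨by simp, (σ, j * m), hi, ⟨rfl, by dsimp only; omega⟩, rfl⟩
    · rintro ⟨-, z, -, ⟨-, h2⟩, h1⟩
      rw [show z.2 = j * m from h1] at h2
      omega
  · obtain ⟨h1, h2⟩ := hw
    obtain ⟨h3, h4⟩ := hw'
    rw [adj_b_b]
    constructor
    · rintro ⟨rfl, h⟩
      refine ⟨fun e => ?_, (σ, min i j), (min_le_left _ _).trans h2, ⟨rfl, ?_⟩, rfl, ?_⟩
      · injection e
        omega
      · dsimp only
        omega
      · dsimp only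
        omega
    · rintro ⟨hne, z, -, ⟨rfl, h5⟩, rfl, h6⟩
      have : i ≠ j := fun e => hne (e ▸ rfl)
      exact ⟨rfl, by omega⟩

end LV

namespace PV

/-- The position of a vertex on the boundary paths. -/
def pos (m : ℕ) : PV → Bool × ℕ
  | u i => (false, i * m)
  | v i => (true, i * m)
  | p i j => (false, (i - 1) * m + j)
  | q i j => (true, (i - 1) * m + j)

variable {m t i i' j j' : ℕ} {x y : PV}

lemma block_eq (hj : j < m) (hj' : j' < m) : i * m + j = i' * m + j' ↔ i = i' ∧ j = j' := by
  rcases lt_trichotomy i i' with h | rfl | h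
  · have := LV.mul_add_le m h
    omega
  · omega
  · have := LV.mul_add_le m h
    omega

lemma block_succ_eq (hj : j < m) (hj' : j' < m) : i * m + j + 1 = i' * m + j' ↔
    (i = i' ∧ j + 1 = j') ∨ (i + 1 = i' ∧ j + 1 = m ∧ j' = 0) := by
  rcases Nat.lt_or_ge (j + 1) m with h | h
  · rw [add_assoc, block_eq h hj']
    omega
  · have h1 : i * m + j + 1 = (i + 1) * m + 0 := by
      rw [Nat.succ_mul]
      omega
    rw [h1, block_eq (by omega) hj']
    omega

/-- The side of a vertex, the polygon to the right of it, and its position there. -/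
def coord : PV → Bool × ℕ × ℕ
  | u i => (false, i, 0)
  | v i => (true, i, 0)
  | p i j => (false, i - 1, j)
  | q i j => (true, i - 1, j)

lemma pos_eq (x : PV) : pos m x = ((coord x).1, (coord x).2.1 * m + (coord x).2.2) := by
  cases x <;> rfl

lemma coord_lt (hm : 1 ≤ m) (hx : x ∈ PVset (m + 1) t) : (coord x).2.2 < m := by
  cases x
  · exact hm
  · exact hm
  · have : _ ∧ _ ∧ _ ∧ _ := hx
    dsimp only [coord]
    omega
  · have : _ ∧ _ ∧ _ ∧ _ := hx
    dsimp only [coord]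
    omega

lemma pos_injOn (hm : 1 ≤ m) : Set.InjOn (pos m) (PVset (m + 1) t) := by
  intro x hx y hy h
  rw [pos_eq, pos_eq, Prod.mk.injEq, block_eq (coord_lt hm hx) (coord_lt hm hy)] at h
  rcases x <;> rcases y <;> simp [coord, PVset] at h hx hy ⊢ <;> omega

lemma pos_le (hx : x ∈ PVset (m + 1) t) : (pos m x).2 ≤ t * m := by
  rcases x with i | i | ⟨i, j⟩ | ⟨i, j⟩
  · exact Nat.mul_le_mul_right m hx
  · exact Nat.mul_le_mul_right m hx
  · obtain ⟨h1, h2, h3, h4⟩ : _ ∧ _ ∧ _ ∧ _ := hx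
    have := LV.mul_add_le m (show i - 1 < t by omega)
    dsimp only [pos]
    omega
  · obtain ⟨h1, h2, h3, h4⟩ : _ ∧ _ ∧ _ ∧ _ := hx
    have := LV.mul_add_le m (show i - 1 < t by omega)
    dsimp only [pos]
    omega

lemma exists_pos (hm : 1 ≤ m) {z : Bool × ℕ} (hz : z.2 ≤ t * m) :
    ∃ x ∈ PVset (m + 1) t, pos m x = z := by
  obtain ⟨σ, k⟩ := z
  have hk := Nat.div_add_mod' k m
  have hr := Nat.mod_lt k hm
  rcases Nat.eq_zero_or_pos (k % m) with h0 | h0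
  · have ht : k / m ≤ t := Nat.div_le_of_le_mul (by rwa [mul_comm])
    rcases σ
    · exact ⟨u (k / m), ht, Prod.ext rfl (by dsimp only [pos]; omega)⟩
    · exact ⟨v (k / m), ht, Prod.ext rfl (by dsimp only [pos]; omega)⟩
  · have ht : k / m < t := by
      by_contra h
      have := Nat.mul_le_mul_right m (not_lt.1 h)
      dsimp only at hz
      omega
    have hmem : 1 ≤ k / m + 1 ∧ k / m + 1 ≤ t ∧ 1 ≤ k % m ∧ k % m ≤ m + 1 - 2 :=
      ⟨Nat.succ_pos _, ht, h0, by omega⟩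
    rcases σ
    · exact ⟨p (k / m + 1) (k % m), hmem, Prod.ext rfl hk⟩
    · exact ⟨q (k / m + 1) (k % m), hmem, Prod.ext rfl hk⟩

lemma adj_iff_ladder (hm : 1 ≤ m) (hx : x ∈ PVset (m + 1) t) (hy : y ∈ PVset (m + 1) t) :
    (pFull (m + 1)).Adj x y ↔ LV.Ladder m (pos m x) (pos m y) := by
  have hx' := coord_lt hm hx
  have hy' := coord_lt hm hy
  have hmul : (∃ i, (coord x).2.1 * m + (coord x).2.2 = i * m) ↔ (coord x).2.2 = 0 := by
    constructor
    · rintro ⟨i, hi⟩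
      exact ((block_eq hx' hm).1 (hi.trans (add_zero _).symm)).2
    · exact fun h => ⟨(coord x).2.1, by omega⟩
  rw [LV.Ladder, pos_eq, pos_eq, block_eq hx' hy', block_succ_eq hx' hy', block_succ_eq hy' hx',
    hmul, pFull, SimpleGraph.fromRel_adj]
  rcases x <;> rcases y <;> simp [coord, PVset, pRel] at hx hy ⊢ <;> omega

end PV

lemma exists_edge {m t : ℕ} (hm : 1 ≤ m) {w : LV} (hw : w ∈ LV.strip (t + 1) fun _ => t * m) :
    ∃ E ∈ (polyP (m + 1) t).edgeSet, ∀ x, x ∈ E ↔ LV.Inc m w (PV.pos m x.1) := by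
  obtain ⟨z, z', hz, hz', h, hinc⟩ := LV.exists_ladder hw
  obtain ⟨x, hx, rfl⟩ := PV.exists_pos hm hz
  obtain ⟨y, hy, rfl⟩ := PV.exists_pos hm hz'
  refine ⟨s(⟨x, hx⟩, ⟨y, hy⟩), (PV.adj_iff_ladder hm hx hy).2 h, fun w => ?_⟩
  rw [hinc, (PV.pos_injOn hm).eq_iff w.2 hx, (PV.pos_injOn hm).eq_iff w.2 hy, Sym2.mem_iff,
    Subtype.ext_iff, Subtype.ext_iff]

lemma exists_of_edge {m t : ℕ} (hm : 1 ≤ m) {E : Sym2 (PVset (m + 1) t)}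
    (hE : E ∈ (polyP (m + 1) t).edgeSet) :
    ∃ w ∈ LV.strip (t + 1) fun _ => t * m, ∀ x, x ∈ E ↔ LV.Inc m w (PV.pos m x.1) := by
  induction E with
  | _ x y =>
    obtain ⟨w, hw, hinc⟩ := LV.exists_of_ladder hm (PV.pos_le x.2) (PV.pos_le y.2)
      ((PV.adj_iff_ladder hm x.2 y.2).1 hE)
    refine ⟨w, hw, fun z => ?_⟩
    rw [hinc, (PV.pos_injOn hm).eq_iff z.2 x.2, (PV.pos_injOn hm).eq_iff z.2 y.2, Sym2.mem_iff,
      Subtype.ext_iff, Subtype.ext_iff]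

lemma polyP_homotopyEquiv {m : ℕ} (hm : 1 ≤ m) (t : ℕ) :
    Nonempty (ContinuousMap.HomotopyEquiv (geom (matchCx (polyP (m + 1) t)))
      (geom (indOn (LV.graph m) (LV.strip (t + 1) fun _ => t * m)))) := by
  have : Nonempty (Sym2 (PVset (m + 1) t)) :=
    ⟨s(⟨PV.u 0, Nat.zero_le t⟩, ⟨PV.u 0, Nat.zero_le t⟩)⟩
  choose! e he using fun (w : LV) (hw : w ∈ LV.strip (t + 1) fun _ => t * m) =>
    exists_edge (t := t) hm hw
  refine matchCx_homotopyEquiv (e := e) ⟨fun w hw => (he w hw).1, ?_, ?_⟩ ?_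
  · intro w hw w' hw' h
    refine LV.eq_of_inc hm hw hw' fun z hz => ?_
    obtain ⟨x, hx, rfl⟩ := PV.exists_pos hm hz
    rw [← (he w hw).2 ⟨x, hx⟩, ← (he w' hw').2 ⟨x, hx⟩, h]
  · intro E hE
    obtain ⟨w, hw, h⟩ := exists_of_edge hm hE
    exact ⟨w, hw, Sym2.ext fun x => ((he w hw).2 x).trans (h x).symm⟩
  · intro w hw w' hw'
    rw [LV.adj_iff_inc hw hw' hm]
    refine and_congr_right fun _ => ⟨?_, ?_⟩
    · rintro ⟨z, hz, h, h'⟩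
      obtain ⟨x, hx, rfl⟩ := PV.exists_pos hm hz
      exact ⟨⟨x, hx⟩, ((he w hw).2 _).2 h, ((he w' hw').2 _).2 h'⟩
    · rintro ⟨x, h, h'⟩
      exact ⟨_, PV.pos_le x.2, ((he w hw).2 x).1 h, ((he w' hw').2 x).1 h'⟩

/-- For every `n ≥ 2` and `t ≥ 0`, the matching complex `M(P_{n,t})` of
the polygonal line tiling of `t` `2n`-gons is homotopy equivalent to a wedge of spheres. -/
theorem stmt_9 (n t : ℕ) (hn : 2 ≤ n) :
    ∃ ds : List ℕ, Nonempty (ContinuousMap.HomotopyEquiv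
      (geom (matchCx (polyP n t))) (wedgeOfSpheres ds).carrier) := by
  obtain ⟨m, rfl⟩ : ∃ m, n = m + 1 := ⟨n - 1, by omega⟩
  have hm : 1 ≤ m := by omega
  obtain ⟨d, ds, hd, h⟩ := (LV.strip_isWedge hm t (fun _ => t * m) fun _ => le_rfl).1
  obtain ⟨e⟩ := polyP_homotopyEquiv hm t
  obtain ⟨e'⟩ := h.homotopyEquiv
  exact ⟨ds, ⟨e.trans e'⟩⟩
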